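/- arXiv:2505.24861 — 11 statements merged into one kernel-verified Lean document; each statement's English description precedes it below -/
import Mathlib

section
/- Let ρ = N(m₀, Σ₀) be a Gaussian probability measure on ℝ^d, let α ≥ 0 and λ > 0, and let u ∈ ℝ^d. Then the localized weighted covariance with weight exponent α and distance matrix λΣ₀ satisfies C_{α, λΣ₀}(ρ; u) = (αΣ⁻¹ + (1 + λ⁻¹)Σ₀⁻¹)⁻¹; in particular, it does not depend on u. -/
open MeasureTheory Matrix Real

noncomputable section

/-- Unnormalized Gaussian density `π̂(v) = exp(−(1/2)(v−m)ᵀ Σ⁻¹ (v−m))`. -/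
def pihat {d : ℕ} (m : Fin d → ℝ) (S : Matrix (Fin d) (Fin d) ℝ) (v : Fin d → ℝ) : ℝ :=
  Real.exp (-(1 / 2) * ((v - m) ⬝ᵥ (S⁻¹ *ᵥ (v - m))))

/-- Localized weight `w_{a,A}(v;u) = exp(−(1/2)(v−u)ᵀA⁻¹(v−u)) π̂(v)^a`. -/
def locw {d : ℕ} (pih : (Fin d → ℝ) → ℝ) (a : ℝ) (A : Matrix (Fin d) (Fin d) ℝ)
    (u v : Fin d → ℝ) : ℝ :=
  Real.exp (-(1 / 2) * ((v - u) ⬝ᵥ (A⁻¹ *ᵥ (v - u)))) * pih v ^ a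

/-- Weighted mean of a measure `ρ` with weight function `w`. -/
def wMean {d : ℕ} (w : (Fin d → ℝ) → ℝ) (ρ : Measure (Fin d → ℝ)) : Fin d → ℝ :=
  fun i => (∫ v, w v * v i ∂ρ) / ∫ v, w v ∂ρ

/-- Weighted covariance of a measure `ρ` with weight function `w`. -/
def wCov {d : ℕ} (w : (Fin d → ℝ) → ℝ) (ρ : Measure (Fin d → ℝ)) :
    Matrix (Fin d) (Fin d) ℝ :=
  Matrix.of fun i j =>
    (∫ v, w v * ((v i - wMean w ρ i) * (v j - wMean w ρ j)) ∂ρ) / ∫ v, w v ∂ρ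

/-- The Gaussian probability measure `N(m₀, Σ₀)` on `ℝ^d`. -/
def gaussian {d : ℕ} (m0 : Fin d → ℝ) (S0 : Matrix (Fin d) (Fin d) ℝ) :
    Measure (Fin d → ℝ) :=
  (ENNReal.ofReal (∫ v, pihat m0 S0 v))⁻¹ •
    volume.withDensity fun v => ENNReal.ofReal (pihat m0 S0 v)

lemma integrable_exp_neg_half_sq_mul_pow (n : ℕ) :
    Integrable fun t : ℝ => Real.exp (-(1 / 2) * t ^ 2) * t ^ n := by
  have h := integrable_rpow_mul_exp_neg_mul_sq (b := 1 / 2) (by norm_num) (s := n)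
    (by have : (0 : ℝ) ≤ n := n.cast_nonneg
        linarith)
  refine h.congr (.of_forall fun t => ?_)
  simp only [Real.rpow_natCast]
  ring

lemma integral_exp_neg_half_sq_pos : 0 < ∫ t : ℝ, Real.exp (-(1 / 2) * t ^ 2) := by
  rw [integral_gaussian]
  positivity

lemma integral_exp_neg_half_sq_mul_self :
    ∫ t : ℝ, Real.exp (-(1 / 2) * t ^ 2) * t = 0 := by
  have h := integral_neg_eq_self (fun t : ℝ => Real.exp (-(1 / 2) * t ^ 2) * t) volume
  simp only [neg_sq, mul_neg, integral_neg] at h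
  linarith

lemma integral_exp_neg_half_sq_mul_sq :
    ∫ t : ℝ, Real.exp (-(1 / 2) * t ^ 2) * t ^ 2 = ∫ t : ℝ, Real.exp (-(1 / 2) * t ^ 2) := by
  have h := integral_mul_deriv_eq_deriv_mul_of_integrable (u := fun t : ℝ => t)
    (u' := fun _ => 1) (v := fun t : ℝ => -Real.exp (-(1 / 2) * t ^ 2))
    (v' := fun t => Real.exp (-(1 / 2) * t ^ 2) * t)
    (fun t _ => hasDerivAt_id t)
    (fun t _ => by
      have := (((hasDerivAt_id t).pow 2).const_mul (-(1 / 2) : ℝ)).exp.neg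
      convert! this using 1
      simp)
    ((integrable_exp_neg_half_sq_mul_pow 2).congr (.of_forall fun t => by simp; ring))
    ((integrable_exp_neg_half_sq_mul_pow 0).neg.congr (.of_forall fun t => by simp))
    ((integrable_exp_neg_half_sq_mul_pow 1).neg.congr (.of_forall fun t => by simp; ring))
  simp only [one_mul, integral_neg, neg_neg] at h
  rw [← h]
  exact integral_congr_ae (.of_forall fun t => by ring)

lemma exp_neg_half_dotProduct_mul_prod_pow {d : ℕ} (e : Fin d → ℕ) (x : Fin d → ℝ) :
    Real.exp (-(1 / 2) * (x ⬝ᵥ x)) * ∏ k, x k ^ e k =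
      ∏ k, Real.exp (-(1 / 2) * x k ^ 2) * x k ^ e k := by
  rw [Finset.prod_mul_distrib, ← Real.exp_sum, ← Finset.mul_sum]
  simp only [dotProduct, sq]

lemma prod_pow_ite_eq {d : ℕ} (i : Fin d) (x : Fin d → ℝ) :
    ∏ k, x k ^ (if k = i then 1 else 0) = x i := by
  simp [pow_ite]

lemma integrable_stdGaussian_mul_prod_pow {d : ℕ} (e : Fin d → ℕ) :
    Integrable fun x : Fin d → ℝ =>
      Real.exp (-(1 / 2) * (x ⬝ᵥ x)) * ∏ k, x k ^ e k := by
  simp only [exp_neg_half_dotProduct_mul_prod_pow]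
  exact Integrable.fintype_prod (f := fun k t => Real.exp (-(1 / 2) * t ^ 2) * t ^ e k)
    fun k => integrable_exp_neg_half_sq_mul_pow (e k)

lemma integral_stdGaussian_mul_prod_pow {d : ℕ} (e : Fin d → ℕ) :
    ∫ x : Fin d → ℝ, Real.exp (-(1 / 2) * (x ⬝ᵥ x)) * ∏ k, x k ^ e k =
      ∏ k, ∫ t : ℝ, Real.exp (-(1 / 2) * t ^ 2) * t ^ e k := by
  simp only [exp_neg_half_dotProduct_mul_prod_pow]
  exact integral_fintype_prod_volume_eq_prod
    fun k t => Real.exp (-(1 / 2) * t ^ 2) * t ^ e k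

lemma integrable_stdGaussian (d : ℕ) :
    Integrable fun x : Fin d → ℝ => Real.exp (-(1 / 2) * (x ⬝ᵥ x)) := by
  simpa using integrable_stdGaussian_mul_prod_pow (d := d) 0

lemma integral_stdGaussian (d : ℕ) :
    ∫ x : Fin d → ℝ, Real.exp (-(1 / 2) * (x ⬝ᵥ x)) =
      (∫ t : ℝ, Real.exp (-(1 / 2) * t ^ 2)) ^ d := by
  simpa using integral_stdGaussian_mul_prod_pow (d := d) 0

lemma integral_stdGaussian_pos (d : ℕ) :
    0 < ∫ x : Fin d → ℝ, Real.exp (-(1 / 2) * (x ⬝ᵥ x)) := by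
  rw [integral_stdGaussian]
  exact pow_pos integral_exp_neg_half_sq_pos d

lemma integrable_stdGaussian_mul_coord {d : ℕ} (i : Fin d) :
    Integrable fun x : Fin d → ℝ => Real.exp (-(1 / 2) * (x ⬝ᵥ x)) * x i := by
  simpa only [prod_pow_ite_eq] using
    integrable_stdGaussian_mul_prod_pow fun k => if k = i then 1 else 0

lemma integral_stdGaussian_mul_coord {d : ℕ} (i : Fin d) :
    ∫ x : Fin d → ℝ, Real.exp (-(1 / 2) * (x ⬝ᵥ x)) * x i = 0 := by
  have h := integral_stdGaussian_mul_prod_pow fun k => if k = i then 1 else 0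
  simp only [prod_pow_ite_eq] at h
  rw [h]
  exact Finset.prod_eq_zero (Finset.mem_univ i)
    (by simpa using integral_exp_neg_half_sq_mul_self)

lemma integrable_stdGaussian_mul_coord_mul_coord {d : ℕ} (i j : Fin d) :
    Integrable fun x : Fin d → ℝ => Real.exp (-(1 / 2) * (x ⬝ᵥ x)) * (x i * x j) := by
  simpa only [pow_add, Finset.prod_mul_distrib, prod_pow_ite_eq] using
    integrable_stdGaussian_mul_prod_pow
      fun k => (if k = i then 1 else 0) + (if k = j then 1 else 0)

lemma integral_stdGaussian_mul_coord_mul_coord {d : ℕ} (i j : Fin d) :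
    ∫ x : Fin d → ℝ, Real.exp (-(1 / 2) * (x ⬝ᵥ x)) * (x i * x j) =
      (∫ x : Fin d → ℝ, Real.exp (-(1 / 2) * (x ⬝ᵥ x))) *
        (1 : Matrix (Fin d) (Fin d) ℝ) i j := by
  have h := integral_stdGaussian_mul_prod_pow
    fun k => (if k = i then 1 else 0) + (if k = j then 1 else 0)
  simp only [pow_add, Finset.prod_mul_distrib, prod_pow_ite_eq] at h
  simp only [← pow_add] at h
  rw [h]
  by_cases hij : i = j
  · subst hij
    rw [Matrix.one_apply_eq, mul_one, integral_stdGaussian]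
    rw [Finset.prod_congr rfl (g := fun _ => ∫ t : ℝ, Real.exp (-(1 / 2) * t ^ 2))]
    · simp
    · intro k _
      by_cases hk : k = i
      · simpa [hk] using integral_exp_neg_half_sq_mul_sq
      · simp [hk]
  · rw [Matrix.one_apply_ne hij, mul_zero]
    exact Finset.prod_eq_zero (Finset.mem_univ i)
      (by simpa [hij] using integral_exp_neg_half_sq_mul_self)

open scoped MatrixOrder in
lemma Matrix.PosDef.exists_mul_transpose {d : ℕ} {A : Matrix (Fin d) (Fin d) ℝ}
    (hA : A.PosDef) : ∃ R : Matrix (Fin d) (Fin d) ℝ, R.det ≠ 0 ∧ A = R * Rᵀ := by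
  obtain ⟨B, hB⟩ := CStarAlgebra.nonneg_iff_eq_star_mul_self.mp hA.posSemidef.nonneg
  rw [Matrix.star_eq_conjTranspose, Matrix.conjTranspose_eq_transpose_of_trivial] at hB
  refine ⟨Bᵀ, fun h => ?_, by simpa using hB⟩
  have := hA.det_pos
  rw [hB, det_mul, h, zero_mul] at this
  exact lt_irrefl _ this

lemma integral_eq_abs_det_mul_integral_affine {d : ℕ} (p : Fin d → ℝ)
    {R : Matrix (Fin d) (Fin d) ℝ} (hR : R.det ≠ 0) (f : (Fin d → ℝ) → ℝ) :
    ∫ v, f v = |R.det| * ∫ x, f (p + R *ᵥ x) := by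
  have hemb : MeasurableEmbedding (toLin' R) := by
    let e := LinearEquiv.ofIsUnitDet (f := toLin' R) (v := Pi.basisFun ℝ (Fin d))
      (v' := Pi.basisFun ℝ (Fin d)) (by simpa [LinearMap.toMatrix_eq_toMatrix'] using hR)
    exact e.toContinuousLinearEquiv.toHomeomorph.measurableEmbedding
  have h := hemb.integral_map (μ := volume) fun v => f (p + v)
  rw [Real.map_matrix_volume_pi_eq_smul_volume_pi hR, integral_smul_measure,
    integral_add_left_eq_self, ENNReal.toReal_ofReal (abs_nonneg _), abs_inv, smul_eq_mul] at h
  simp only [toLin'_apply] at h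
  rw [← h, mul_inv_cancel_left₀ (abs_ne_zero.mpr hR)]

lemma pihat_affine {d : ℕ} (p : Fin d → ℝ) {S R : Matrix (Fin d) (Fin d) ℝ}
    (hR : R.det ≠ 0) (hS : S = R * Rᵀ) (x : Fin d → ℝ) :
    pihat p S (p + R *ᵥ x) = Real.exp (-(1 / 2) * (x ⬝ᵥ x)) := by
  have hu : IsUnit R.det := isUnit_iff_ne_zero.mpr hR
  have h : S⁻¹ *ᵥ (R *ᵥ x) = (Rᵀ)⁻¹ *ᵥ x := by
    rw [hS, Matrix.mul_inv_rev, mulVec_mulVec, Matrix.mul_assoc, nonsing_inv_mul _ hu,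
      Matrix.mul_one]
  rw [pihat, add_sub_cancel_left, h, dotProduct_comm, dotProduct_mulVec, ← mulVec_transpose,
    mulVec_mulVec, Matrix.mul_nonsing_inv _ (by simpa using hu), one_mulVec]

lemma integral_pihat_pos {d : ℕ} (p : Fin d → ℝ) {S : Matrix (Fin d) (Fin d) ℝ}
    (hS : S.PosDef) : 0 < ∫ v, pihat p S v := by
  obtain ⟨R, hR, hSR⟩ := hS.exists_mul_transpose
  rw [integral_eq_abs_det_mul_integral_affine p hR]
  simp only [pihat_affine p hR hSR]
  exact mul_pos (abs_pos.mpr hR) (integral_stdGaussian_pos d)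

lemma continuous_pihat {d : ℕ} (p : Fin d → ℝ) (S : Matrix (Fin d) (Fin d) ℝ) :
    Continuous (pihat p S) := by
  unfold pihat
  fun_prop

lemma integral_gaussian_measure {d : ℕ} (m0 : Fin d → ℝ) {S0 : Matrix (Fin d) (Fin d) ℝ}
    (hS0 : S0.PosDef) (f : (Fin d → ℝ) → ℝ) :
    ∫ v, f v ∂gaussian m0 S0 = (∫ v, pihat m0 S0 v)⁻¹ * ∫ v, pihat m0 S0 v * f v := by
  rw [gaussian, integral_smul_measure, ENNReal.toReal_inv,
    ENNReal.toReal_ofReal (integral_pihat_pos m0 hS0).le, smul_eq_mul,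
    integral_withDensity_eq_integral_toReal_smul
      (continuous_pihat m0 S0).measurable.ennreal_ofReal
      (.of_forall fun _ => ENNReal.ofReal_lt_top)]
  simp only [ENNReal.toReal_ofReal (Real.exp_pos _).le, pihat, smul_eq_mul]

/-- If integration against `w ρ` is, up to a nonzero constant, integration against the Gaussian
density with mean `p` and covariance `R Rᵀ`, then the weighted covariance is `R Rᵀ`. -/
lemma wCov_eq_of_integral_eq {d : ℕ} {w : (Fin d → ℝ) → ℝ} {ρ : Measure (Fin d → ℝ)}
    {C : ℝ} (hC : C ≠ 0) (p : Fin d → ℝ) (R : Matrix (Fin d) (Fin d) ℝ)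
    (h : ∀ f : (Fin d → ℝ) → ℝ, ∫ v, w v * f v ∂ρ =
      C * ∫ x, Real.exp (-(1 / 2) * (x ⬝ᵥ x)) * f (p + R *ᵥ x)) :
    wCov w ρ = R * Rᵀ := by
  set Z := ∫ x : Fin d → ℝ, Real.exp (-(1 / 2) * (x ⬝ᵥ x)) with hZ
  have hZ0 : Z ≠ 0 := (integral_stdGaussian_pos d).ne'
  have hw : ∫ v, w v ∂ρ = C * Z := by simpa only [mul_one] using h fun _ => 1
  have hmean : wMean w ρ = p := by
    funext i
    have hcoord : ∫ x : Fin d → ℝ, Real.exp (-(1 / 2) * (x ⬝ᵥ x)) * (p + R *ᵥ x) i =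
        Z * p i := by
      have hx : ∀ x : Fin d → ℝ, Real.exp (-(1 / 2) * (x ⬝ᵥ x)) * (p + R *ᵥ x) i =
          Real.exp (-(1 / 2) * (x ⬝ᵥ x)) * p i +
            ∑ k, R i k * (Real.exp (-(1 / 2) * (x ⬝ᵥ x)) * x k) := by
        intro x
        simp only [Pi.add_apply, mulVec, dotProduct, mul_add, Finset.mul_sum]
        congr 1
        exact Finset.sum_congr rfl fun k _ => by ring
      simp only [hx]
      rw [integral_add ((integrable_stdGaussian d).mul_const _)
        (integrable_finsetSum _ fun k _ => (integrable_stdGaussian_mul_coord k).const_mul _),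
        integral_finsetSum _ fun k _ => (integrable_stdGaussian_mul_coord k).const_mul _,
        integral_mul_const]
      simp only [integral_const_mul, integral_stdGaussian_mul_coord, mul_zero,
        Finset.sum_const_zero, add_zero, hZ]
    rw [wMean, hw, h fun v => v i, hcoord]
    field_simp
  ext i j
  have hcov : ∫ x : Fin d → ℝ, Real.exp (-(1 / 2) * (x ⬝ᵥ x)) *
      (((p + R *ᵥ x) i - p i) * ((p + R *ᵥ x) j - p j)) = Z * (R * Rᵀ) i j := by
    have hx : ∀ x : Fin d → ℝ, Real.exp (-(1 / 2) * (x ⬝ᵥ x)) *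
        (((p + R *ᵥ x) i - p i) * ((p + R *ᵥ x) j - p j)) =
        ∑ k, ∑ l, R i k * R j l * (Real.exp (-(1 / 2) * (x ⬝ᵥ x)) * (x k * x l)) := by
      intro x
      simp only [Pi.add_apply, add_sub_cancel_left, mulVec, dotProduct]
      rw [Finset.sum_mul_sum, Finset.mul_sum]
      refine Finset.sum_congr rfl fun k _ => ?_
      rw [Finset.mul_sum]
      exact Finset.sum_congr rfl fun l _ => by ring
    have hint : ∀ k l, Integrable fun x : Fin d → ℝ =>
        R i k * R j l * (Real.exp (-(1 / 2) * (x ⬝ᵥ x)) * (x k * x l)) := fun k l =>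
      (integrable_stdGaussian_mul_coord_mul_coord k l).const_mul _
    simp only [hx]
    rw [integral_finsetSum _ fun k _ => integrable_finsetSum _ fun l _ => hint k l,
      Matrix.mul_apply, Finset.mul_sum]
    refine Finset.sum_congr rfl fun k _ => ?_
    rw [integral_finsetSum _ fun l _ => hint k l]
    simp only [integral_const_mul, integral_stdGaussian_mul_coord_mul_coord, Matrix.one_apply,
      mul_ite, mul_one, mul_zero, Finset.sum_ite_eq, Finset.mem_univ, if_true, transpose_apply,
      ← hZ]
    ring
  rw [wCov, of_apply, hmean, hw, h fun v => (v i - p i) * (v j - p j), hcov]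
  field_simp

/-- Expansion of a symmetric quadratic form around its centre. -/
lemma dotProduct_mulVec_sub_sub {d : ℕ} {A : Matrix (Fin d) (Fin d) ℝ} (hA : Aᵀ = A)
    (v c : Fin d → ℝ) :
    (v - c) ⬝ᵥ (A *ᵥ (v - c)) = v ⬝ᵥ (A *ᵥ v) - 2 * (v ⬝ᵥ (A *ᵥ c)) + c ⬝ᵥ (A *ᵥ c) := by
  have h : c ⬝ᵥ (A *ᵥ v) = v ⬝ᵥ (A *ᵥ c) := by
    rw [dotProduct_mulVec, ← mulVec_transpose, hA, dotProduct_comm]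
  simp only [mulVec_sub, sub_dotProduct, dotProduct_sub, h]
  ring

lemma Matrix.PosDef.transpose_inv_eq {d : ℕ} {A : Matrix (Fin d) (Fin d) ℝ} (hA : A.PosDef) :
    (A⁻¹)ᵀ = A⁻¹ := by
  simpa [Matrix.IsHermitian] using hA.inv.isHermitian

/-- Completing the square in the product of the Gaussian density and the localized weight. -/
lemma exists_pihat_mul_locw_eq {d : ℕ} (m m0 : Fin d → ℝ)
    {S S0 : Matrix (Fin d) (Fin d) ℝ} (hS : S.PosDef) (hS0 : S0.PosDef)
    {α l : ℝ} (hl : 0 < l) (u : Fin d → ℝ)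
    (hP : (α • S⁻¹ + (1 + l⁻¹) • S0⁻¹).PosDef) :
    ∃ (p : Fin d → ℝ) (K : ℝ), K ≠ 0 ∧ ∀ v,
      pihat m0 S0 v * locw (pihat m S) α (l • S0) u v =
        K * pihat p (α • S⁻¹ + (1 + l⁻¹) • S0⁻¹)⁻¹ v := by
  set P := α • S⁻¹ + (1 + l⁻¹) • S0⁻¹ with hPdef
  have hPu : IsUnit P.det := isUnit_iff_ne_zero.mpr hP.det_pos.ne'
  set b := α • (S⁻¹ *ᵥ m) + l⁻¹ • (S0⁻¹ *ᵥ u) + S0⁻¹ *ᵥ m0 with hb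
  have hPp : P *ᵥ (P⁻¹ *ᵥ b) = b := by
    rw [mulVec_mulVec, mul_nonsing_inv _ hPu, one_mulVec]
  have hlS : (l • S0)⁻¹ = l⁻¹ • S0⁻¹ := by
    have := Matrix.inv_smul' S0 (Units.mk0 l hl.ne') (isUnit_iff_ne_zero.mpr hS0.det_pos.ne')
    simpa [Units.smul_def] using this
  refine ⟨P⁻¹ *ᵥ b, Real.exp (-(1 / 2) * (m0 ⬝ᵥ (S0⁻¹ *ᵥ m0) + l⁻¹ * (u ⬝ᵥ (S0⁻¹ *ᵥ u)) +
    α * (m ⬝ᵥ (S⁻¹ *ᵥ m)) - (P⁻¹ *ᵥ b) ⬝ᵥ b)), (Real.exp_pos _).ne', fun v => ?_⟩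
  have hPt : Pᵀ = P := by simpa [Matrix.IsHermitian] using hP.isHermitian
  rw [pihat, locw, pihat, pihat, ← Real.exp_mul, ← Real.exp_add, ← Real.exp_add, ← Real.exp_add,
    hlS, nonsing_inv_nonsing_inv _ hPu, smul_mulVec, dotProduct_smul,
    dotProduct_mulVec_sub_sub hPt, dotProduct_mulVec_sub_sub hS.transpose_inv_eq,
    dotProduct_mulVec_sub_sub hS0.transpose_inv_eq, dotProduct_mulVec_sub_sub hS0.transpose_inv_eq,
    hPp]
  have h1 : v ⬝ᵥ (P *ᵥ v) = α * (v ⬝ᵥ (S⁻¹ *ᵥ v)) + (1 + l⁻¹) * (v ⬝ᵥ (S0⁻¹ *ᵥ v)) := by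
    simp only [hPdef, add_mulVec, smul_mulVec, dotProduct_add, dotProduct_smul, smul_eq_mul]
  have h2 : v ⬝ᵥ b = α * (v ⬝ᵥ (S⁻¹ *ᵥ m)) + l⁻¹ * (v ⬝ᵥ (S0⁻¹ *ᵥ u)) +
      v ⬝ᵥ (S0⁻¹ *ᵥ m0) := by
    simp only [hb, dotProduct_add, dotProduct_smul, smul_eq_mul]
  rw [h1, h2, smul_eq_mul]
  congr 1
  ring

/-- For a Gaussian `ρ = N(m₀, Σ₀)`, `α ≥ 0`, `λ > 0` and any `u ∈ ℝ^d`, the localized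
weighted covariance with weight exponent `α` and distance matrix `λΣ₀` satisfies
`C_{α,λΣ₀}(ρ; u) = (αΣ⁻¹ + (1 + λ⁻¹)Σ₀⁻¹)⁻¹`; in particular it does not depend on `u`. -/
theorem locCov_gaussian {d : ℕ} (hd : 1 ≤ d) (m m0 : Fin d → ℝ)
    (S S0 : Matrix (Fin d) (Fin d) ℝ) (hS : S.PosDef) (hS0 : S0.PosDef)
    (α l : ℝ) (hα : 0 ≤ α) (hl : 0 < l) (u : Fin d → ℝ) :
    wCov (locw (pihat m S) α (l • S0) u) (gaussian m0 S0) =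
      (α • S⁻¹ + (1 + l⁻¹) • S0⁻¹)⁻¹ := by
  have hP : (α • S⁻¹ + (1 + l⁻¹) • S0⁻¹).PosDef :=
    (hS0.inv.smul (by positivity : 0 < 1 + l⁻¹)).posSemidef_add (hS.inv.posSemidef.smul hα)
  obtain ⟨p, K, hK, hprod⟩ := exists_pihat_mul_locw_eq m m0 hS hS0 hl u hP
  obtain ⟨R, hR, hPR⟩ := hP.inv.exists_mul_transpose
  have hZ := (integral_pihat_pos m0 hS0).ne'
  refine Eq.trans ?_ hPR.symm
  refine wCov_eq_of_integral_eq (C := (∫ v, pihat m0 S0 v)⁻¹ * (K * |R.det|))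
    (mul_ne_zero (inv_ne_zero hZ) (mul_ne_zero hK (abs_ne_zero.mpr hR))) p R fun f => ?_
  rw [integral_gaussian_measure m0 hS0]
  have hint : ∀ v, pihat m0 S0 v * (locw (pihat m S) α (l • S0) u v * f v) =
      K * (pihat p (α • S⁻¹ + (1 + l⁻¹) • S0⁻¹)⁻¹ v * f v) := fun v => by
    rw [← mul_assoc, hprod, mul_assoc]
  simp only [hint, integral_const_mul]
  rw [integral_eq_abs_det_mul_integral_affine p hR
    fun v => pihat p (α • S⁻¹ + (1 + l⁻¹) • S0⁻¹)⁻¹ v * f v]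
  simp only [pihat_affine p hR hPR, mul_assoc]
end
end

section
/- Let ρ = N(m₀, Σ₀) be a Gaussian probability measure on ℝ^d, let α > 0, and set C_α := (αΣ⁻¹ + Σ₀⁻¹)⁻¹ (which equals the weighted covariance C_α(ρ)). Then for every u ∈ ℝ^d, 2 (u − μ_{α, C_α}(ρ; u)) = u − μ_α(ρ). Equivalently, with the parameter choices κ = β = α and γ = 2α/(α+1), the localized drift satisfies (γ/κ)(u − μ_{β, κC_α(ρ)/β}(ρ; u)) = (α+1)⁻¹ (u − μ_α(ρ)), so that for Gaussian initial and target distributions the localized consensus-based dynamics reduce to the consensus-based sampling drift. -/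
open MeasureTheory Matrix Real

noncomputable section

/-- The function `f`, of positive total mass, has mean `c` and covariance `C` after normalization, with all
moments of order at most two being integrable. -/
structure HasMoments {d : ℕ} (f : (Fin d → ℝ) → ℝ) (c : Fin d → ℝ)
    (C : Matrix (Fin d) (Fin d) ℝ) : Prop where
  integrable : Integrable f
  integral_pos : 0 < ∫ v, f v
  integrable_sub : ∀ i, Integrable fun v => f v * (v i - c i)
  integral_sub : ∀ i, ∫ v, f v * (v i - c i) = 0
  integrable_sub_mul_sub : ∀ i j, Integrable fun v => f v * ((v i - c i) * (v j - c j))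
  integral_sub_mul_sub : ∀ i j,
    ∫ v, f v * ((v i - c i) * (v j - c j)) = C i j * ∫ v, f v

lemma integrable_pow_mul_exp_neg_half_sq (n : ℕ) :
    Integrable fun x : ℝ => x ^ n * Real.exp (-(1 / 2) * x ^ 2) := by
  have h := integrable_rpow_mul_exp_neg_mul_sq (b := 1 / 2) (by norm_num) (s := n)
    (by have : (0 : ℝ) ≤ n := n.cast_nonneg
        linarith)
  simpa only [Real.rpow_natCast] using h

lemma integral_mul_exp_neg_half_sq : ∫ x : ℝ, x * Real.exp (-(1 / 2) * x ^ 2) = 0 := by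
  have h := integral_neg_eq_self (fun x : ℝ => x * Real.exp (-(1 / 2) * x ^ 2)) volume
  simp only [neg_sq, neg_mul, integral_neg] at h ⊢
  linarith

lemma integral_sq_mul_exp_neg_half_sq :
    ∫ x : ℝ, x ^ 2 * Real.exp (-(1 / 2) * x ^ 2) = ∫ x : ℝ, Real.exp (-(1 / 2) * x ^ 2) := by
  have h0 := integrable_pow_mul_exp_neg_half_sq 0
  have h1 := integrable_pow_mul_exp_neg_half_sq 1
  have h2 := integrable_pow_mul_exp_neg_half_sq 2
  have hd : ∀ x : ℝ, HasDerivAt (fun x : ℝ => -Real.exp (-(1 / 2) * x ^ 2))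
      (x * Real.exp (-(1 / 2) * x ^ 2)) x := by
    intro x
    have h := (((hasDerivAt_pow 2 x).const_mul (-(1 / 2) : ℝ)).exp).neg
    refine h.congr_deriv ?_
    push_cast
    ring
  have h := integral_mul_deriv_eq_deriv_mul_of_integrable (u := fun x : ℝ => x)
    (u' := fun _ => 1) (fun x _ => hasDerivAt_id' x) (fun x _ => hd x)
    (h2.congr (.of_forall fun x => by simp only [Pi.mul_apply]; ring))
    (h0.neg.congr (.of_forall fun x => by simp))
    (h1.neg.congr (.of_forall fun x => by simp))
  simp only [one_mul, integral_neg, neg_neg] at h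
  rw [← h]
  congr 1 with x
  ring

lemma prod_pow_single {d : ℕ} (k : Fin d) (x : Fin d → ℝ) :
    ∏ i, x i ^ (Pi.single k 1 : Fin d → ℕ) i = x k := by
  rw [Finset.prod_eq_single k]
  · simp
  · intro b _ hb
    simp [Pi.single_eq_of_ne hb]
  · simp

lemma prod_pow_mul_exp {d : ℕ} (e : Fin d → ℕ) (x : Fin d → ℝ) :
    ∏ i, (x i ^ e i * Real.exp (-(1 / 2) * x i ^ 2)) =
      Real.exp (-(1 / 2) * (x ⬝ᵥ x)) * ∏ i, x i ^ e i := by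
  rw [Finset.prod_mul_distrib, ← Real.exp_sum, ← Finset.mul_sum, mul_comm]
  simp only [dotProduct, sq]

lemma integrable_exp_mul_monomial {d : ℕ} (e : Fin d → ℕ) :
    Integrable fun x : Fin d → ℝ => Real.exp (-(1 / 2) * (x ⬝ᵥ x)) * ∏ i, x i ^ e i := by
  simp only [← prod_pow_mul_exp]
  exact Integrable.fintype_prod (f := fun i (t : ℝ) => t ^ e i * Real.exp (-(1 / 2) * t ^ 2))
    fun i => integrable_pow_mul_exp_neg_half_sq (e i)

lemma integral_exp_mul_monomial {d : ℕ} (e : Fin d → ℕ) :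
    ∫ x : Fin d → ℝ, Real.exp (-(1 / 2) * (x ⬝ᵥ x)) * ∏ i, x i ^ e i =
      ∏ i, ∫ t : ℝ, t ^ e i * Real.exp (-(1 / 2) * t ^ 2) := by
  simp only [← prod_pow_mul_exp]
  exact integral_fintype_prod_volume_eq_prod
    (fun i (t : ℝ) => t ^ e i * Real.exp (-(1 / 2) * t ^ 2))

lemma hasMoments_standard {d : ℕ} :
    HasMoments (fun x : Fin d → ℝ => Real.exp (-(1 / 2) * (x ⬝ᵥ x))) 0 1 := by
  have hone : ∀ (k : Fin d) (x : Fin d → ℝ), x k = ∏ i, x i ^ (Pi.single k 1 : Fin d → ℕ) i :=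
    fun k x => (prod_pow_single k x).symm
  have htwo : ∀ (k l : Fin d) (x : Fin d → ℝ),
      x k * x l = ∏ i, x i ^ (Pi.single k 1 + Pi.single l 1 : Fin d → ℕ) i := by
    intro k l x
    simp only [Pi.add_apply, pow_add, Finset.prod_mul_distrib, prod_pow_single]
  have hzero : ∫ x : Fin d → ℝ, Real.exp (-(1 / 2) * (x ⬝ᵥ x)) =
      ∏ _i : Fin d, ∫ t : ℝ, Real.exp (-(1 / 2) * t ^ 2) := by
    simpa using integral_exp_mul_monomial (0 : Fin d → ℕ)
  refine ⟨?_, ?_, ?_, ?_, ?_, ?_⟩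
  · simpa using integrable_exp_mul_monomial (0 : Fin d → ℕ)
  · rw [hzero]
    refine Finset.prod_pos fun i _ => ?_
    rw [integral_gaussian]
    positivity
  · intro k
    simp only [Pi.zero_apply, sub_zero]
    simp only [hone k]
    exact integrable_exp_mul_monomial _
  · intro k
    simp only [Pi.zero_apply, sub_zero]
    simp only [hone k]
    rw [integral_exp_mul_monomial]
    refine Finset.prod_eq_zero (Finset.mem_univ k) ?_
    simpa using integral_mul_exp_neg_half_sq
  · intro k l
    simp only [Pi.zero_apply, sub_zero, htwo]
    exact integrable_exp_mul_monomial _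
  · intro k l
    simp only [Pi.zero_apply, sub_zero, htwo]
    rw [integral_exp_mul_monomial]
    by_cases hkl : k = l
    · subst hkl
      rw [Matrix.one_apply_eq, one_mul, hzero]
      refine Finset.prod_congr rfl fun i _ => ?_
      by_cases hi : i = k
      · subst hi
        simpa using integral_sq_mul_exp_neg_half_sq
      · simp [Pi.single_eq_of_ne hi]
    · rw [Matrix.one_apply_ne hkl, zero_mul]
      refine Finset.prod_eq_zero (Finset.mem_univ k) ?_
      simpa [Pi.single_eq_of_ne hkl] using integral_mul_exp_neg_half_sq

lemma measurableEmbedding_mulVec {d : ℕ} {B : Matrix (Fin d) (Fin d) ℝ} (hB : B.det ≠ 0) :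
    MeasurableEmbedding fun v : Fin d → ℝ => B *ᵥ v := by
  have hc : Continuous fun v : Fin d → ℝ => B *ᵥ v := by fun_prop
  exact hc.measurableEmbedding
    (Matrix.mulVec_injective_iff_isUnit.2 ((Matrix.isUnit_iff_isUnit_det B).2 hB.isUnit))

lemma map_mulVec_volume {d : ℕ} {B : Matrix (Fin d) (Fin d) ℝ} (hB : B.det ≠ 0) :
    Measure.map (fun v : Fin d → ℝ => B *ᵥ v) volume =
      ENNReal.ofReal |B.det⁻¹| • (volume : Measure (Fin d → ℝ)) :=
  Real.map_matrix_volume_pi_eq_smul_volume_pi hB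

lemma integral_comp_mulVec {d : ℕ} {B : Matrix (Fin d) (Fin d) ℝ} (hB : B.det ≠ 0)
    (f : (Fin d → ℝ) → ℝ) : ∫ v, f (B *ᵥ v) = |B.det⁻¹| * ∫ v, f v := by
  rw [← (measurableEmbedding_mulVec hB).integral_map, map_mulVec_volume hB, integral_smul_measure,
    ENNReal.toReal_ofReal (abs_nonneg _), smul_eq_mul]

lemma integrable_comp_mulVec {d : ℕ} {B : Matrix (Fin d) (Fin d) ℝ} (hB : B.det ≠ 0)
    {f : (Fin d → ℝ) → ℝ} (hf : Integrable f) : Integrable fun v => f (B *ᵥ v) := by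
  have h := hf.smul_measure (c := ENNReal.ofReal |B.det⁻¹|) ENNReal.ofReal_ne_top
  rw [← map_mulVec_volume hB] at h
  exact ((measurableEmbedding_mulVec hB).integrable_map_iff).1 h

lemma HasMoments.comp_mulVec {d : ℕ} {f : (Fin d → ℝ) → ℝ} {C B : Matrix (Fin d) (Fin d) ℝ}
    (hf : HasMoments f 0 C) (hB : B.det ≠ 0) :
    HasMoments (fun v => f (B *ᵥ v)) 0 (B⁻¹ * C * B⁻¹ᵀ) := by
  have hinv : ∀ (v : Fin d → ℝ) (i : Fin d), (B⁻¹ *ᵥ (B *ᵥ v)) i = v i := by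
    intro v i
    rw [Matrix.mulVec_mulVec, Matrix.nonsing_inv_mul _ hB.isUnit, Matrix.one_mulVec]
  have hI1 := hf.integrable_sub
  have hE1 := hf.integral_sub
  have hI2 := hf.integrable_sub_mul_sub
  have hE2 := hf.integral_sub_mul_sub
  simp only [Pi.zero_apply, sub_zero] at hI1 hE1 hI2 hE2
  have h1 : ∀ i, (fun w : Fin d → ℝ => f w * (B⁻¹ *ᵥ w) i) =
      fun w => ∑ k, B⁻¹ i k * (f w * w k) := by
    intro i
    ext w
    simp only [Matrix.mulVec, dotProduct, Finset.mul_sum]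
    exact Finset.sum_congr rfl fun k _ => by ring
  have h2 : ∀ i j, (fun w : Fin d → ℝ => f w * ((B⁻¹ *ᵥ w) i * (B⁻¹ *ᵥ w) j)) =
      fun w => ∑ k, ∑ l, B⁻¹ i k * B⁻¹ j l * (f w * (w k * w l)) := by
    intro i j
    ext w
    simp only [Matrix.mulVec, dotProduct]
    simp only [Finset.sum_mul_sum]
    simp only [Finset.mul_sum]
    exact Finset.sum_congr rfl fun k _ => Finset.sum_congr rfl fun l _ => by ring
  refine ⟨integrable_comp_mulVec hB hf.integrable, ?_, ?_, ?_, ?_, ?_⟩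
  · rw [integral_comp_mulVec hB]
    exact mul_pos (abs_pos.2 (inv_ne_zero hB)) hf.integral_pos
  · intro i
    simp only [Pi.zero_apply, sub_zero]
    suffices h : Integrable fun w => f w * (B⁻¹ *ᵥ w) i by
      simpa only [hinv] using integrable_comp_mulVec hB h
    rw [h1]
    exact integrable_finsetSum _ fun k _ => (hI1 k).const_mul _
  · intro i
    simp only [Pi.zero_apply, sub_zero]
    have h := integral_comp_mulVec hB fun w => f w * (B⁻¹ *ᵥ w) i
    simp only [hinv] at h
    rw [h, h1,
      integral_finsetSum _ fun k _ => (hI1 k).const_mul _]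
    simp [integral_const_mul, hE1]
  · intro i j
    simp only [Pi.zero_apply, sub_zero]
    suffices h : Integrable fun w => f w * ((B⁻¹ *ᵥ w) i * (B⁻¹ *ᵥ w) j) by
      simpa only [hinv] using integrable_comp_mulVec hB h
    rw [h2]
    exact integrable_finsetSum _ fun k _ => integrable_finsetSum _ fun l _ =>
      (hI2 k l).const_mul _
  · intro i j
    simp only [Pi.zero_apply, sub_zero]
    have h := integral_comp_mulVec hB fun w => f w * ((B⁻¹ *ᵥ w) i * (B⁻¹ *ᵥ w) j)
    simp only [hinv] at h
    rw [h, h2,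
      integral_finsetSum _ fun k _ => integrable_finsetSum _ fun l _ => (hI2 k l).const_mul _,
      integral_comp_mulVec hB]
    simp_rw [integral_finsetSum _ fun l _ => (hI2 _ l).const_mul _, integral_const_mul, hE2]
    simp only [Matrix.mul_apply, Matrix.transpose_apply, Finset.sum_mul, Finset.mul_sum]
    rw [Finset.sum_comm]
    exact Finset.sum_congr rfl fun l _ => Finset.sum_congr rfl fun k _ => by ring

lemma HasMoments.comp_sub {d : ℕ} {f : (Fin d → ℝ) → ℝ} {C : Matrix (Fin d) (Fin d) ℝ}
    (hf : HasMoments f 0 C) (c : Fin d → ℝ) : HasMoments (fun v => f (v - c)) c C := by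
  have hI1 := hf.integrable_sub
  have hE1 := hf.integral_sub
  have hI2 := hf.integrable_sub_mul_sub
  have hE2 := hf.integral_sub_mul_sub
  simp only [Pi.zero_apply, sub_zero] at hI1 hE1 hI2 hE2
  refine ⟨hf.integrable.comp_sub_right c, ?_, fun i => (hI1 i).comp_sub_right c, fun i => ?_,
    fun i j => (hI2 i j).comp_sub_right c, fun i j => ?_⟩
  · rw [integral_sub_right_eq_self f c]
    exact hf.integral_pos
  · exact (integral_sub_right_eq_self (fun w => f w * w i) c).trans (hE1 i)
  · rw [integral_sub_right_eq_self f c]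
    exact (integral_sub_right_eq_self (fun w => f w * (w i * w j)) c).trans (hE2 i j)

lemma HasMoments.const_mul {d : ℕ} {f : (Fin d → ℝ) → ℝ} {c : Fin d → ℝ}
    {C : Matrix (Fin d) (Fin d) ℝ} (hf : HasMoments f c C) {K : ℝ} (hK : 0 < K) :
    HasMoments (fun v => K * f v) c C := by
  refine ⟨hf.integrable.const_mul K, ?_, fun i => ?_, fun i => ?_, fun i j => ?_, fun i j => ?_⟩
  · rw [integral_const_mul]
    exact mul_pos hK hf.integral_pos
  · simpa only [mul_assoc] using (hf.integrable_sub i).const_mul K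
  · simp only [mul_assoc, integral_const_mul, hf.integral_sub, mul_zero]
  · simpa only [mul_assoc] using (hf.integrable_sub_mul_sub i j).const_mul K
  · simp only [mul_assoc, integral_const_mul, hf.integral_sub_mul_sub]
    ring

open scoped MatrixOrder in
lemma hasMoments_exp_quadratic {d : ℕ} {P : Matrix (Fin d) (Fin d) ℝ} (hP : P.PosDef)
    (c : Fin d → ℝ) :
    HasMoments (fun v => Real.exp (-(1 / 2) * ((v - c) ⬝ᵥ (P *ᵥ (v - c))))) c P⁻¹ := by
  obtain ⟨B, hB⟩ := CStarAlgebra.nonneg_iff_eq_star_mul_self.mp hP.posSemidef.nonneg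
  have hB' : P = Bᵀ * B := by
    rw [hB, Matrix.star_eq_conjTranspose, Matrix.conjTranspose_eq_transpose_of_trivial]
  have hdet : B.det ≠ 0 := by
    intro h
    have := hP.det_pos
    rw [hB', Matrix.det_mul, h, mul_zero] at this
    exact this.false
  have h := (hasMoments_standard.comp_mulVec hdet).comp_sub c
  rw [Matrix.mul_one, Matrix.transpose_nonsing_inv, ← Matrix.mul_inv_rev, ← hB'] at h
  convert h using 4 with v
  rw [hB', ← Matrix.mulVec_mulVec, Matrix.dotProduct_mulVec, Matrix.vecMul_transpose]

lemma integral_gaussian_eq {d : ℕ} (m0 : Fin d → ℝ) (S0 : Matrix (Fin d) (Fin d) ℝ)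
    (g : (Fin d → ℝ) → ℝ) :
    ∫ v, g v ∂gaussian m0 S0 =
      (ENNReal.ofReal (∫ v, pihat m0 S0 v))⁻¹.toReal * ∫ v, pihat m0 S0 v * g v := by
  have hm : Measurable fun v => ENNReal.ofReal (pihat m0 S0 v) := by
    have : Continuous (pihat m0 S0) := by
      unfold pihat
      fun_prop
    exact this.measurable.ennreal_ofReal
  rw [gaussian, integral_smul_measure, smul_eq_mul,
    integral_withDensity_eq_integral_toReal_smul hm (by simp)]
  congr 2 with v
  rw [ENNReal.toReal_ofReal (by exact (Real.exp_pos _).le), smul_eq_mul]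

section WeightedMoments

variable {d : ℕ} {m0 : Fin d → ℝ} {S0 : Matrix (Fin d) (Fin d) ℝ} {w : (Fin d → ℝ) → ℝ}
  {c : Fin d → ℝ} {C : Matrix (Fin d) (Fin d) ℝ}

lemma normalization_ne_zero (hS0 : S0.PosDef) :
    (ENNReal.ofReal (∫ v, pihat m0 S0 v))⁻¹.toReal ≠ 0 := by
  have h : 0 < ∫ v, pihat m0 S0 v := (hasMoments_exp_quadratic hS0.inv m0).integral_pos
  rw [ENNReal.toReal_inv, ENNReal.toReal_ofReal h.le]
  exact inv_ne_zero h.ne'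

lemma wMean_gaussian_eq (hS0 : S0.PosDef)
    (h : HasMoments (fun v => pihat m0 S0 v * w v) c C) : wMean w (gaussian m0 S0) = c := by
  ext i
  rw [wMean, integral_gaussian_eq, integral_gaussian_eq,
    mul_div_mul_left _ _ (normalization_ne_zero hS0), div_eq_iff h.integral_pos.ne']
  have h1 : ∀ v, pihat m0 S0 v * (w v * v i) =
      pihat m0 S0 v * w v * (v i - c i) + c i * (pihat m0 S0 v * w v) := fun v => by ring
  simp_rw [h1]
  rw [integral_add (h.integrable_sub i) (h.integrable.const_mul _), h.integral_sub,
    integral_const_mul, zero_add]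

lemma wCov_gaussian_eq (hS0 : S0.PosDef)
    (h : HasMoments (fun v => pihat m0 S0 v * w v) c C) : wCov w (gaussian m0 S0) = C := by
  ext i j
  rw [wCov, Matrix.of_apply, wMean_gaussian_eq hS0 h, integral_gaussian_eq, integral_gaussian_eq,
    mul_div_mul_left _ _ (normalization_ne_zero hS0), div_eq_iff h.integral_pos.ne',
    ← h.integral_sub_mul_sub]
  simp only [mul_assoc]

end WeightedMoments

/-- Completing the square for a sum of two quadratic forms with centres `a` and `b`. -/
lemma quadratic_add_quadratic {d : ℕ} {A B : Matrix (Fin d) (Fin d) ℝ} (hA : Aᵀ = A)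
    (hB : Bᵀ = B) {a b c : Fin d → ℝ} (hc : (A + B) *ᵥ c = A *ᵥ a + B *ᵥ b) (v : Fin d → ℝ) :
    (v - a) ⬝ᵥ (A *ᵥ (v - a)) + (v - b) ⬝ᵥ (B *ᵥ (v - b)) =
      (v - c) ⬝ᵥ ((A + B) *ᵥ (v - c)) +
        ((a ⬝ᵥ (A *ᵥ a) + b ⬝ᵥ (B *ᵥ b)) - c ⬝ᵥ ((A + B) *ᵥ c)) := by
  have hexp : ∀ {M : Matrix (Fin d) (Fin d) ℝ} (_ : Mᵀ = M) (x : Fin d → ℝ),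
      (v - x) ⬝ᵥ (M *ᵥ (v - x)) = v ⬝ᵥ (M *ᵥ v) - 2 * (v ⬝ᵥ (M *ᵥ x)) + x ⬝ᵥ (M *ᵥ x) := by
    intro M hM x
    have hsymm : x ⬝ᵥ (M *ᵥ v) = v ⬝ᵥ (M *ᵥ x) := by
      rw [Matrix.dotProduct_mulVec, ← Matrix.mulVec_transpose, hM, dotProduct_comm]
    simp only [Matrix.mulVec_sub, dotProduct_sub, sub_dotProduct, hsymm]
    ring
  rw [hexp hA, hexp hB, hexp (by rw [Matrix.transpose_add, hA, hB]), hc, Matrix.add_mulVec,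
    dotProduct_add, dotProduct_add]
  ring

/-- The product of two Gaussian profiles is a positive multiple of a Gaussian profile. -/
lemma exp_quadratic_mul_exp_quadratic {d : ℕ} {A B : Matrix (Fin d) (Fin d) ℝ} (hA : Aᵀ = A)
    (hB : Bᵀ = B) {a b c : Fin d → ℝ} (hc : (A + B) *ᵥ c = A *ᵥ a + B *ᵥ b) :
    ∃ K : ℝ, 0 < K ∧ ∀ v : Fin d → ℝ,
      Real.exp (-(1 / 2) * ((v - a) ⬝ᵥ (A *ᵥ (v - a)))) *
          Real.exp (-(1 / 2) * ((v - b) ⬝ᵥ (B *ᵥ (v - b)))) =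
        K * Real.exp (-(1 / 2) * ((v - c) ⬝ᵥ ((A + B) *ᵥ (v - c)))) := by
  refine ⟨_, Real.exp_pos
    (-(1 / 2) * ((a ⬝ᵥ (A *ᵥ a) + b ⬝ᵥ (B *ᵥ b)) - c ⬝ᵥ ((A + B) *ᵥ c))), fun v => ?_⟩
  rw [← Real.exp_add, ← Real.exp_add, ← mul_add, ← mul_add, quadratic_add_quadratic hA hB hc v,
    add_comm]

lemma pihat_rpow {d : ℕ} (m : Fin d → ℝ) (S : Matrix (Fin d) (Fin d) ℝ) (α : ℝ)
    (v : Fin d → ℝ) :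
    pihat m S v ^ α = Real.exp (-(1 / 2) * ((v - m) ⬝ᵥ ((α • S⁻¹) *ᵥ (v - m)))) := by
  rw [pihat, ← Real.exp_mul, Matrix.smul_mulVec, dotProduct_smul, smul_eq_mul]
  congr 1
  ring

/-- For Gaussian `ρ = N(m₀, Σ₀)` and `α > 0`, with `C_α := (αΣ⁻¹ + Σ₀⁻¹)⁻¹` (which
equals the weighted covariance `C_α(ρ)`), for every `u`:
`2(u − μ_{α,C_α}(ρ;u)) = u − μ_α(ρ)`; equivalently, with `κ = β = α` and
`γ = 2α/(α+1)`, `(γ/κ)(u − μ_{β,κC_α/β}(ρ;u)) = (α+1)⁻¹(u − μ_α(ρ))`, so the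
localized consensus-based dynamics reduce to the consensus-based sampling drift. -/
theorem locMean_reduces_to_cbs {d : ℕ} (hd : 1 ≤ d) (m m0 : Fin d → ℝ)
    (S S0 : Matrix (Fin d) (Fin d) ℝ) (hS : S.PosDef) (hS0 : S0.PosDef)
    (α : ℝ) (hα : 0 < α)
    (Cα : Matrix (Fin d) (Fin d) ℝ) (hCα : Cα = (α • S⁻¹ + S0⁻¹)⁻¹)
    (κ β γ : ℝ) (hκ : κ = α) (hβ : β = α) (hγ : γ = 2 * α / (α + 1)) :
    Cα = wCov (fun v => pihat m S v ^ α) (gaussian m0 S0) ∧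
    (∀ u : Fin d → ℝ,
      (2 : ℝ) • (u - wMean (locw (pihat m S) α Cα u) (gaussian m0 S0)) =
        u - wMean (fun v => pihat m S v ^ α) (gaussian m0 S0)) ∧
    (∀ u : Fin d → ℝ,
      (γ / κ) • (u - wMean (locw (pihat m S) β ((κ / β) • Cα) u) (gaussian m0 S0)) =
        (α + 1)⁻¹ • (u - wMean (fun v => pihat m S v ^ α) (gaussian m0 S0))) := by
  have hA : (α • S⁻¹).PosDef := hS.inv.smul hα
  have hP : (α • S⁻¹ + S0⁻¹).PosDef := hA.add hS0.inv
  have symm : ∀ {M : Matrix (Fin d) (Fin d) ℝ}, M.PosDef → Mᵀ = M := fun hM => by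
    simpa [Matrix.conjTranspose_eq_transpose_of_trivial] using hM.isHermitian.eq
  set P : Matrix (Fin d) (Fin d) ℝ := α • S⁻¹ + S0⁻¹ with hPdef
  have hPdet : IsUnit P.det := hP.det_pos.ne'.isUnit
  set c : Fin d → ℝ := P⁻¹ *ᵥ ((α • S⁻¹) *ᵥ m + S0⁻¹ *ᵥ m0) with hcdef
  have hc : P *ᵥ c = (α • S⁻¹) *ᵥ m + S0⁻¹ *ᵥ m0 := by
    rw [hcdef, Matrix.mulVec_mulVec, Matrix.mul_nonsing_inv _ hPdet, Matrix.one_mulVec]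
  obtain ⟨K, hK, hprod⟩ := exp_quadratic_mul_exp_quadratic (symm hA) (symm hS0.inv) hc
  have hglob : HasMoments (fun v => pihat m0 S0 v * pihat m S v ^ α) c P⁻¹ := by
    convert (hasMoments_exp_quadratic hP c).const_mul hK using 2 with v
    rw [mul_comm, pihat_rpow, pihat, hprod]
  have hCinv : Cα⁻¹ = P := by rw [hCα, Matrix.nonsing_inv_nonsing_inv _ hPdet]
  have hloc : ∀ u : Fin d → ℝ,
      wMean (locw (pihat m S) α Cα u) (gaussian m0 S0) = (1 / 2 : ℝ) • (u + c) := by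
    intro u
    have hcu : (P + P) *ᵥ ((1 / 2 : ℝ) • (u + c)) = P *ᵥ u + P *ᵥ c := by
      rw [Matrix.add_mulVec, ← Matrix.mulVec_add, ← Matrix.mulVec_add, ← add_smul]
      norm_num
    obtain ⟨L, hL, hprod'⟩ := exp_quadratic_mul_exp_quadratic (symm hP) (symm hP) hcu
    refine wMean_gaussian_eq hS0 (C := (P + P)⁻¹) ?_
    convert (hasMoments_exp_quadratic (hP.add hP) ((1 / 2 : ℝ) • (u + c))).const_mul
      (mul_pos hK hL) using 2 with v
    rw [mul_assoc, ← hprod' v, mul_left_comm, ← hprod v, locw, pihat_rpow, pihat, hCinv]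
    ring
  have hmean := wMean_gaussian_eq hS0 hglob
  refine ⟨by rw [wCov_gaussian_eq hS0 hglob, hCα], fun u => ?_, fun u => ?_⟩
  · rw [hloc, hmean]
    module
  · have hα1 : α + 1 ≠ 0 := by positivity
    rw [hκ, hβ, hγ, div_self hα.ne', one_smul, hloc, hmean]
    ext i
    simp only [Pi.smul_apply, Pi.sub_apply, Pi.add_apply, smul_eq_mul]
    field_simp
    ring
end
end

section
/- Let Σ and C be symmetric positive definite real d×d matrices that commute (ΣC = CΣ), let β, κ, γ > 0, and define P := (βΣ⁻¹ + Σ⁻¹ + (β/κ)C⁻¹)⁻¹. Then C − (γ/κ)Σ + (γβ/(2κ²))(P C⁻¹ Σ + Σ P C⁻¹) = C − γ (κΣ⁻¹ + (β/(β+1)) C⁻¹)⁻¹. Moreover, this expression equals the zero matrix whenever κ I = (γ − β/(β+1)) Σ C⁻¹. -/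
open Matrix

noncomputable section

/-- Key computation for the covariance ODE of localized consensus-based sampling:
for commuting symmetric positive definite `Σ`, `C` and `β, κ, γ > 0`, with
`P := (βΣ⁻¹ + Σ⁻¹ + (β/κ)C⁻¹)⁻¹`, one has
`C − (γ/κ)Σ + (γβ/(2κ²))(P C⁻¹ Σ + Σ P C⁻¹) = C − γ(κΣ⁻¹ + (β/(β+1))C⁻¹)⁻¹`,
and this expression vanishes whenever `κI = (γ − β/(β+1)) Σ C⁻¹`. -/
theorem covarianceODE_rhs_simplification {d : ℕ} (hd : 1 ≤ d)
    (S C P : Matrix (Fin d) (Fin d) ℝ) (hS : S.PosDef) (hC : C.PosDef)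
    (hcomm : S * C = C * S) (β κ γ : ℝ) (hβ : 0 < β) (hκ : 0 < κ) (hγ : 0 < γ)
    (hP : P = (β • S⁻¹ + S⁻¹ + (β / κ) • C⁻¹)⁻¹) :
    (C - (γ / κ) • S + (γ * β / (2 * κ ^ 2)) • (P * C⁻¹ * S + S * (P * C⁻¹)) =
        C - γ • (κ • S⁻¹ + (β / (β + 1)) • C⁻¹)⁻¹) ∧
      (κ • (1 : Matrix (Fin d) (Fin d) ℝ) = (γ - β / (β + 1)) • (S * C⁻¹) →
        C - (γ / κ) • S + (γ * β / (2 * κ ^ 2)) • (P * C⁻¹ * S + S * (P * C⁻¹)) = 0) := by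
  have hSu : IsUnit S.det := (isUnit_iff_isUnit_det S).mp hS.isUnit
  have hCu : IsUnit C.det := (isUnit_iff_isUnit_det C).mp hC.isUnit
  have hβ1 : β + 1 ≠ 0 := by positivity
  have hSS : S⁻¹ * S = 1 := nonsing_inv_mul S hSu
  have hSS' : S * S⁻¹ = 1 := mul_nonsing_inv S hSu
  have hSC : S * C⁻¹ = C⁻¹ * S := by
    calc S * C⁻¹ = C⁻¹ * (C * S) * C⁻¹ := by
          rw [nonsing_inv_mul_cancel_left _ _ hCu]
      _ = C⁻¹ * S := by
          rw [← hcomm, Matrix.mul_assoc, Matrix.mul_assoc, mul_nonsing_inv C hCu, Matrix.mul_one]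
  set M := β • S⁻¹ + S⁻¹ + (β / κ) • C⁻¹ with hM
  have hMpos : M.PosDef :=
    ((hS.inv.smul hβ).add hS.inv).add (hC.inv.smul (div_pos hβ hκ))
  have hMu : IsUnit M.det := (isUnit_iff_isUnit_det M).mp hMpos.isUnit
  have hMS : M * S = (β + 1) • (1 : Matrix (Fin d) (Fin d) ℝ) + (β / κ) • (C⁻¹ * S) := by
    simp only [hM, Matrix.add_mul, Matrix.smul_mul, hSS, add_smul, one_smul]
  have hSM : S * M = M * S := by
    rw [hMS, hM]
    simp only [Matrix.mul_add, Matrix.mul_smul, hSS', hSC, add_smul, one_smul]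
  have hPM : P * M = 1 := by rw [hP, nonsing_inv_mul M hMu]
  have hMP : M * P = 1 := by rw [hP, mul_nonsing_inv M hMu]
  have hSP : S * P = P * S := by
    calc S * P = P * (M * S) * P := by rw [← Matrix.mul_assoc, hPM, Matrix.one_mul]
      _ = P * S := by
          rw [← hSM, Matrix.mul_assoc, Matrix.mul_assoc, hMP, Matrix.mul_one]
  have hSPC : S * (P * C⁻¹) = P * C⁻¹ * S := by
    rw [← Matrix.mul_assoc, hSP, Matrix.mul_assoc, hSC, Matrix.mul_assoc]
  have hS_eq : S = (β + 1) • P + (β / κ) • (P * C⁻¹ * S) := by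
    calc S = P * (M * S) := by rw [← Matrix.mul_assoc, hPM, Matrix.one_mul]
      _ = _ := by
          rw [hMS, Matrix.mul_add, Matrix.mul_smul, Matrix.mul_smul, Matrix.mul_one,
            Matrix.mul_assoc]
  have hN : κ • S⁻¹ + (β / (β + 1)) • C⁻¹ = (κ / (β + 1)) • M := by
    rw [hM]
    match_scalars <;> field_simp
  have hNinv : (κ • S⁻¹ + (β / (β + 1)) • C⁻¹)⁻¹ = ((β + 1) / κ) • P := by
    apply inv_eq_right_inv
    rw [hN, smul_mul_smul_comm, hMP, div_mul_div_cancel₀ hβ1, div_self hκ.ne', one_smul]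
  have hmain : C - (γ / κ) • S + (γ * β / (2 * κ ^ 2)) • (P * C⁻¹ * S + S * (P * C⁻¹)) =
      C - γ • (κ • S⁻¹ + (β / (β + 1)) • C⁻¹)⁻¹ := by
    rw [hNinv, hSPC]
    generalize P * C⁻¹ * S = X at hS_eq
    rw [hS_eq]
    match_scalars <;> field_simp
    ring
  refine ⟨hmain, fun h => ?_⟩
  have hA : κ • S⁻¹ = (γ - β / (β + 1)) • C⁻¹ := by
    have := congrArg (S⁻¹ * ·) h
    simpa only [Matrix.mul_smul, Matrix.mul_one, ← Matrix.mul_assoc, hSS, Matrix.one_mul] using this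
  have hNC : (κ • S⁻¹ + (β / (β + 1)) • C⁻¹)⁻¹ = γ⁻¹ • C := by
    apply inv_eq_right_inv
    rw [hA, ← add_smul, sub_add_cancel, smul_mul_smul_comm, nonsing_inv_mul C hCu,
      mul_inv_cancel₀ hγ.ne', one_smul]
  rw [hmain, hNC, smul_inv_smul₀ hγ.ne', sub_self]
end
end

section
/- Let Σ be a symmetric positive definite real d×d matrix, let β, κ > 0, set C := Σ (the unweighted covariance preconditioner at the stationary point), γ := κ + β/(β+1), and P := (βΣ⁻¹ + Σ⁻¹ + (β/κ)C⁻¹)⁻¹. Then C − (γ/κ)Σ + (γβ/(2κ²))(P C⁻¹ Σ + Σ P C⁻¹) = 0. Consequently, for a Gaussian target N(m, Σ), the constant functions m_t ≡ m and Σ_t ≡ Σ are an equilibrium of the mean-field moment ODEs of localized consensus-based sampling with preconditioner C(ρ_t) and this choice of γ. -/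
open Matrix

noncomputable section

/-- For a symmetric positive definite `Σ`, `β, κ > 0`, the unweighted covariance
preconditioner `C := Σ` at the stationary point, `γ := κ + β/(β+1)`, and
`P := (βΣ⁻¹ + Σ⁻¹ + (β/κ)C⁻¹)⁻¹`, the right-hand side of the covariance moment ODE
of localized consensus-based sampling vanishes:
`C − (γ/κ)Σ + (γβ/(2κ²))(P C⁻¹ Σ + Σ P C⁻¹) = 0`.
Consequently `m_t ≡ m`, `Σ_t ≡ Σ` is an equilibrium of the mean-field moment ODEs. -/
theorem stationary_gaussian_unweighted_cov {d : ℕ} (hd : 1 ≤ d)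
    (S : Matrix (Fin d) (Fin d) ℝ) (hS : S.PosDef)
    (β κ γ : ℝ) (hβ : 0 < β) (hκ : 0 < κ)
    (C : Matrix (Fin d) (Fin d) ℝ) (hC : C = S)
    (hγ : γ = κ + β / (β + 1))
    (P : Matrix (Fin d) (Fin d) ℝ)
    (hP : P = (β • S⁻¹ + S⁻¹ + (β / κ) • C⁻¹)⁻¹) :
    C - (γ / κ) • S + (γ * β / (2 * κ ^ 2)) • (P * C⁻¹ * S + S * (P * C⁻¹)) = 0 := by
  subst hC
  have hdet : IsUnit C.det := hS.det_pos.ne'.isUnit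
  have hc : β + 1 + β / κ ≠ 0 := by positivity
  have hP' : P = (β + 1 + β / κ)⁻¹ • C := by
    have hsum : β • C⁻¹ + C⁻¹ + (β / κ) • C⁻¹ = (β + 1 + β / κ) • C⁻¹ := by
      simp only [add_smul, one_smul]
    rw [hP, hsum]
    apply Matrix.inv_eq_left_inv
    rw [smul_mul_smul_comm, inv_mul_cancel₀ hc, one_smul, Matrix.mul_nonsing_inv _ hdet]
  have hcoef : 1 - γ / κ + γ * β / (2 * κ ^ 2) * (2 * (β + 1 + β / κ)⁻¹) = 0 := by
    have hγ' : γ = κ * (β + 1 + β / κ) / (β + 1) := by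
      rw [hγ]
      field_simp
    rw [hγ']
    field_simp
    ring
  have hPC : P * C⁻¹ = (β + 1 + β / κ)⁻¹ • (1 : Matrix (Fin d) (Fin d) ℝ) := by
    rw [hP', smul_mul_assoc, Matrix.mul_nonsing_inv _ hdet]
  calc C - (γ / κ) • C + (γ * β / (2 * κ ^ 2)) • (P * C⁻¹ * C + C * (P * C⁻¹))
      = (1 - γ / κ + γ * β / (2 * κ ^ 2) * (2 * (β + 1 + β / κ)⁻¹)) • C := by
        rw [hPC, smul_mul_assoc, one_mul, mul_smul_comm, mul_one]
        module
    _ = 0 := by rw [hcoef, zero_smul]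
end
end

section
/- Let Σ be a symmetric positive definite real d×d matrix, let α ≥ 0 and β, κ > 0, set C := (αΣ⁻¹ + Σ⁻¹)⁻¹ = (α+1)⁻¹Σ (the weighted covariance preconditioner C_α at the stationary point), γ := κ/(α+1) + β/(β+1), and P := (βΣ⁻¹ + Σ⁻¹ + (β/κ)C⁻¹)⁻¹. Then C − (γ/κ)Σ + (γβ/(2κ²))(P C⁻¹ Σ + Σ P C⁻¹) = 0. Consequently, for a Gaussian target N(m, Σ), the constant functions m_t ≡ m and Σ_t ≡ Σ are an equilibrium of the mean-field moment ODEs of localized consensus-based sampling with preconditioner C_α(ρ_t) and this choice of γ. -/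
open Matrix

noncomputable section

/-- For a symmetric positive definite `Σ`, `α ≥ 0`, `β, κ > 0`, the weighted covariance
preconditioner `C := (αΣ⁻¹ + Σ⁻¹)⁻¹ = (α+1)⁻¹Σ` at the stationary point,
`γ := κ/(α+1) + β/(β+1)`, and `P := (βΣ⁻¹ + Σ⁻¹ + (β/κ)C⁻¹)⁻¹`, the right-hand side of
the covariance moment ODE of localized consensus-based sampling vanishes:
`C − (γ/κ)Σ + (γβ/(2κ²))(P C⁻¹ Σ + Σ P C⁻¹) = 0`.
Consequently `m_t ≡ m`, `Σ_t ≡ Σ` is an equilibrium of the mean-field moment ODEs. -/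
theorem stationary_gaussian_weighted_cov {d : ℕ} (hd : 1 ≤ d)
    (S : Matrix (Fin d) (Fin d) ℝ) (hS : S.PosDef)
    (α β κ γ : ℝ) (hα : 0 ≤ α) (hβ : 0 < β) (hκ : 0 < κ)
    (C : Matrix (Fin d) (Fin d) ℝ) (hC : C = (α • S⁻¹ + S⁻¹)⁻¹)
    (hγ : γ = κ / (α + 1) + β / (β + 1))
    (P : Matrix (Fin d) (Fin d) ℝ)
    (hP : P = (β • S⁻¹ + S⁻¹ + (β / κ) • C⁻¹)⁻¹) :
    C = (α + 1)⁻¹ • S ∧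
      C - (γ / κ) • S + (γ * β / (2 * κ ^ 2)) • (P * C⁻¹ * S + S * (P * C⁻¹)) = 0 := by
  have ha : α + 1 ≠ 0 := by positivity
  have hb : β + 1 ≠ 0 := by positivity
  have hκ' : κ ≠ 0 := hκ.ne'
  have hSdet : IsUnit S.det := hS.det_pos.ne'.isUnit
  have inv_smul_inv : ∀ c : ℝ, c ≠ 0 → (c • S⁻¹)⁻¹ = c⁻¹ • S := fun c hc =>
    inv_eq_left_inv
      (by rw [smul_mul_smul_comm, inv_mul_cancel₀ hc, mul_nonsing_inv S hSdet, one_smul])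
  have hC' : C = (α + 1)⁻¹ • S := by
    rw [hC, ← inv_smul_inv _ ha, add_smul, one_smul]
  have hCinv : C⁻¹ = (α + 1) • S⁻¹ := by
    rw [hC']
    exact inv_eq_left_inv
      (by rw [smul_mul_smul_comm, mul_inv_cancel₀ ha, nonsing_inv_mul S hSdet, one_smul])
  have hc : β + 1 + β / κ * (α + 1) ≠ 0 := by positivity
  have hPC : P * C⁻¹ = ((β + 1 + β / κ * (α + 1))⁻¹ * (α + 1)) • 1 := by
    have hP' : P = (β + 1 + β / κ * (α + 1))⁻¹ • S := by
      rw [hP, hCinv, ← inv_smul_inv _ hc, add_smul _ (β / κ * (α + 1)), add_smul β, one_smul,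
        mul_smul]
    rw [hP', hCinv, smul_mul_smul_comm, mul_nonsing_inv S hSdet]
  refine ⟨hC', ?_⟩
  rw [hPC, hC', smul_one_mul, mul_smul_one, ← add_smul, smul_smul, ← sub_smul, ← add_smul]
  convert zero_smul ℝ S using 2
  have hc' : κ * (β + 1) + β * (α + 1) ≠ 0 := by positivity
  have hcinv : (β + 1 + β / κ * (α + 1))⁻¹ = κ / (κ * (β + 1) + β * (α + 1)) := by
    field_simp
  rw [hcinv, hγ]
  field_simp
  ring
end
end

section
/- Let Σ be a symmetric positive definite real d×d matrix, let α ≥ 0, λ > 0 and β, κ > 0, set C := (λ⁻¹ + α + 1)⁻¹ Σ (the localized weighted covariance preconditioner C_{α, λΣ} at the stationary point), γ := (λ⁻¹ + α + 1)⁻¹ κ + β/(β+1), and P := (βΣ⁻¹ + Σ⁻¹ + (β/κ)C⁻¹)⁻¹. Then C − (γ/κ)Σ + (γβ/(2κ²))(P C⁻¹ Σ + Σ P C⁻¹) = 0. Consequently, for a Gaussian target N(m, Σ), the constant functions m_t ≡ m and Σ_t ≡ Σ are an equilibrium of the mean-field moment ODEs of localized consensus-based sampling with preconditioner C_{α, λC(ρ_t)}(ρ_t;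 u) and this choice of γ. -/
open Matrix

noncomputable section

/-- For a symmetric positive definite `Σ`, `α ≥ 0`, `λ > 0`, `β, κ > 0`, the localized
weighted covariance preconditioner `C := (λ⁻¹ + α + 1)⁻¹ Σ` at the stationary point,
`γ := (λ⁻¹ + α + 1)⁻¹ κ + β/(β+1)`, and `P := (βΣ⁻¹ + Σ⁻¹ + (β/κ)C⁻¹)⁻¹`, the
right-hand side of the covariance moment ODE of localized consensus-based sampling
vanishes: `C − (γ/κ)Σ + (γβ/(2κ²))(P C⁻¹ Σ + Σ P C⁻¹) = 0`.
Consequently `m_t ≡ m`, `Σ_t ≡ Σ` is an equilibrium of the mean-field moment ODEs. -/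
theorem stationary_gaussian_localized_weighted_cov {d : ℕ} (hd : 1 ≤ d)
    (S : Matrix (Fin d) (Fin d) ℝ) (hS : S.PosDef)
    (α l β κ γ : ℝ) (hα : 0 ≤ α) (hl : 0 < l) (hβ : 0 < β) (hκ : 0 < κ)
    (C : Matrix (Fin d) (Fin d) ℝ) (hC : C = (l⁻¹ + α + 1)⁻¹ • S)
    (hγ : γ = (l⁻¹ + α + 1)⁻¹ * κ + β / (β + 1))
    (P : Matrix (Fin d) (Fin d) ℝ)
    (hP : P = (β • S⁻¹ + S⁻¹ + (β / κ) • C⁻¹)⁻¹) :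
    C - (γ / κ) • S + (γ * β / (2 * κ ^ 2)) • (P * C⁻¹ * S + S * (P * C⁻¹)) = 0 := by
  have hdet : IsUnit S.det := hS.det_pos.ne'.isUnit
  have smul_inv (k : ℝ) (hk : k ≠ 0) (A : Matrix (Fin d) (Fin d) ℝ) (hA : IsUnit A.det) :
      (k • A)⁻¹ = k⁻¹ • A⁻¹ := by
    apply Matrix.inv_eq_right_inv
    rw [smul_mul_smul_comm, mul_nonsing_inv A hA, mul_inv_cancel₀ hk, one_smul]
  have hc : 0 < (l⁻¹ + α + 1)⁻¹ := by positivity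
  generalize (l⁻¹ + α + 1)⁻¹ = c at *
  have hCinv : C⁻¹ = c⁻¹ • S⁻¹ := by rw [hC, smul_inv c hc.ne' S hdet]
  have hPS : P = (β + 1 + β / κ * c⁻¹)⁻¹ • S := by
    have hsum : β • S⁻¹ + S⁻¹ + (β / κ) • C⁻¹ = (β + 1 + β / κ * c⁻¹) • S⁻¹ := by
      rw [hCinv]
      module
    have hq : 0 < β + 1 + β / κ * c⁻¹ := by positivity
    rw [hP, hsum, smul_inv _ hq.ne' _ (isUnit_nonsing_inv_det S hdet),
      nonsing_inv_nonsing_inv S hdet]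
  have hPC : P * C⁻¹ = ((β + 1 + β / κ * c⁻¹)⁻¹ * c⁻¹) • (1 : Matrix (Fin d) (Fin d) ℝ) := by
    rw [hPS, hCinv, smul_mul_smul_comm, mul_nonsing_inv S hdet]
  have hscalar : c - γ / κ
      + γ * β / (2 * κ ^ 2) * (2 * ((β + 1 + β / κ * c⁻¹)⁻¹ * c⁻¹)) = 0 := by
    have hr : (β + 1 + β / κ * c⁻¹)⁻¹ * c⁻¹ = κ / ((β + 1) * κ * c + β) := by
      field_simp
    have hr₀ : 0 < (β + 1) * κ * c + β := by positivity
    have hγ' : γ = ((β + 1) * κ * c + β) / (β + 1) := by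
      rw [hγ]
      field_simp
    rw [hr, hγ']
    field_simp
    ring
  rw [hPC, hC, smul_mul_assoc, one_mul, mul_smul_comm, mul_one]
  generalize (β + 1 + β / κ * c⁻¹)⁻¹ * c⁻¹ = p at hscalar ⊢
  calc _ = (c - γ / κ + γ * β / (2 * κ ^ 2) * (2 * p)) • S := by module
    _ = 0 := by rw [hscalar, zero_smul]
end
end

section
/- Let Σ and Σ_t be symmetric positive definite real d×d matrices and let α, α' > 0. Set κ := α, β := α', γ := 2α'/(α'+1), c := α'/(α(α'+1)), C := (αΣ⁻¹ + (α/α')Σ_t⁻¹)⁻¹, and P := (βΣ⁻¹ + Σ_t⁻¹ + (β/κ)C⁻¹)⁻¹. Then 2[C − (γ/κ)Σ_t + (γβ/(2κ²))(P C⁻¹ Σ_t + Σ_t P C⁻¹)] = −2 c α' Σ_t (Σ + α'Σ_t)⁻¹ (Σ_t − Σ). In other words, the right-hand side of the covariance evolution ODE of localized consensus-based sampling with preconditioner C_{α, λC(ρ_t)}(ρ_t; u), λ = α'/(α−α'), equals c times the right-hand side of the covariance evolution ODE dΣ'_t/dt = −2α'Σ'_t(Σ + α'Σ'_t)⁻¹(Σ'_t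 − Σ) of consensus-based sampling with parameter α'. -/
open Matrix

noncomputable section

/-- `(aA⁻¹ + B⁻¹)⁻¹ = B(A + aB)⁻¹A`, in a form that also records invertibility. -/
lemma mul_inv_mul_mul_smul_inv_add_inv {n : Type*} [Fintype n] [DecidableEq n]
    {A B : Matrix n n ℝ} (hA : IsUnit A.det) (hB : IsUnit B.det) (a : ℝ)
    (hAB : IsUnit (A + a • B).det) :
    (B * (A + a • B)⁻¹ * A) * (a • A⁻¹ + B⁻¹) = 1 := by
  have key : A * (a • A⁻¹ + B⁻¹) = (A + a • B) * B⁻¹ := by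
    rw [mul_add, Matrix.mul_smul, mul_nonsing_inv A hA, add_mul, Matrix.smul_mul,
      mul_nonsing_inv B hB, add_comm]
  rw [mul_assoc, key, mul_assoc, nonsing_inv_mul_cancel_left _ _ hAB, mul_nonsing_inv B hB]

/-- With `κ := α`, `β := α'`, `γ := 2α'/(α'+1)`, `c := α'/(α(α'+1))`,
`C := (αΣ⁻¹ + (α/α')Σ_t⁻¹)⁻¹` and `P := (βΣ⁻¹ + Σ_t⁻¹ + (β/κ)C⁻¹)⁻¹`, the right-hand
side of the covariance ODE of localized consensus-based sampling equals `c` times the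
right-hand side `−2α'Σ_t(Σ + α'Σ_t)⁻¹(Σ_t − Σ)` of the covariance ODE of
consensus-based sampling with parameter `α'`. -/
theorem lcbs_cov_ode_eq_cbs_cov_ode {d : ℕ} (hd : 1 ≤ d)
    (S St : Matrix (Fin d) (Fin d) ℝ) (hS : S.PosDef) (hSt : St.PosDef)
    (α α' : ℝ) (hα : 0 < α) (hα' : 0 < α')
    (κ β γ c : ℝ) (hκ : κ = α) (hβ : β = α') (hγ : γ = 2 * α' / (α' + 1))
    (hc : c = α' / (α * (α' + 1)))
    (C P : Matrix (Fin d) (Fin d) ℝ)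
    (hC : C = (α • S⁻¹ + (α / α') • St⁻¹)⁻¹)
    (hP : P = (β • S⁻¹ + St⁻¹ + (β / κ) • C⁻¹)⁻¹) :
    (2 : ℝ) • (C - (γ / κ) • St + (γ * β / (2 * κ ^ 2)) • (P * C⁻¹ * St + St * (P * C⁻¹))) =
      (-(2 * c * α')) • (St * (S + α' • St)⁻¹ * (St - S)) := by
  subst hκ hβ hγ hc
  have hSu : IsUnit S.det := (isUnit_iff_isUnit_det S).1 hS.isUnit
  have hTu : IsUnit St.det := (isUnit_iff_isUnit_det St).1 hSt.isUnit
  have hKu : IsUnit (S + β • St).det :=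
    (isUnit_iff_isUnit_det _).1 (hS.add (hSt.smul hα')).isUnit
  have hκ₀ := hα.ne'
  have hβ₀ := hα'.ne'
  have hβ₁ : β + 1 ≠ 0 := by positivity
  set M := β • S⁻¹ + St⁻¹ with hM
  set K := S + β • St with hK
  have hNM : (St * K⁻¹ * S) * M = 1 := mul_inv_mul_mul_smul_inv_add_inv hSu hTu β hKu
  have hMN : M * (St * K⁻¹ * S) = 1 := mul_eq_one_comm.1 hNM
  have hCM : κ • S⁻¹ + (κ / β) • St⁻¹ = (κ / β) • M := by
    rw [hM, smul_add, smul_smul, div_mul_cancel₀ _ hβ₀]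
  have hC' : C = (β / κ) • (St * K⁻¹ * S) := by
    rw [hC, hCM]
    apply inv_eq_right_inv
    rw [Matrix.smul_mul, Matrix.mul_smul, hMN, smul_smul, div_mul_div_cancel₀ hβ₀,
      div_self hκ₀, one_smul]
  have hCinv : C⁻¹ = (κ / β) • M := by
    rw [hC']
    apply inv_eq_right_inv
    rw [Matrix.smul_mul, Matrix.mul_smul, hNM, smul_smul, div_mul_div_cancel₀ hκ₀,
      div_self hβ₀, one_smul]
  have hP' : P = (1 / 2 : ℝ) • (St * K⁻¹ * S) := by
    rw [hP, hCinv, smul_smul, div_mul_div_cancel₀ hκ₀, div_self hβ₀, one_smul]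
    apply inv_eq_right_inv
    rw [← two_smul ℝ M, Matrix.smul_mul, Matrix.mul_smul, hMN, smul_smul]
    norm_num
  have hPC : P * C⁻¹ = (κ / (2 * β)) • (1 : Matrix (Fin d) (Fin d) ℝ) := by
    rw [hP', hCinv, Matrix.smul_mul, Matrix.mul_smul, hNM, smul_smul]
    congr 1
    field_simp
  have hSt' : St = St * K⁻¹ * S + β • (St * K⁻¹ * St) := by
    rw [← Matrix.mul_smul, ← mul_add, ← hK, nonsing_inv_mul_cancel_right _ _ hKu]
  rw [hPC, hC', Matrix.smul_mul, Matrix.mul_smul, one_mul, mul_one, mul_sub]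
  generalize St * K⁻¹ * S = X at hSt' ⊢
  generalize St * K⁻¹ * St = Y at hSt' ⊢
  rw [hSt']
  match_scalars <;> field_simp <;> ring
end
end

section
/- Let Σ and Σ_t be symmetric positive definite real d×d matrices and let α, α' > 0. Set κ := α, β := α', γ := 2α'/(α'+1), c := α'/(α(α'+1)), C := (αΣ⁻¹ + (α/α')Σ_t⁻¹)⁻¹, and P := (βΣ⁻¹ + Σ_t⁻¹ + (β/κ)C⁻¹)⁻¹. Then (γβ/κ) P Σ⁻¹ = c α' Σ_t (Σ + α'Σ_t)⁻¹. In other words, the drift matrix in the mean evolution ODE of localized consensus-based sampling with these parameters equals c times the drift matrix in the mean evolution ODE dm'_t/dt = −α'Σ'_t(Σ + α'Σ'_t)⁻¹(m'_t − m) of consensus-based sampling with parameter α'. -/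
open Matrix

noncomputable section

/-- With `κ := α`, `β := α'`, `γ := 2α'/(α'+1)`, `c := α'/(α(α'+1))`,
`C := (αΣ⁻¹ + (α/α')Σ_t⁻¹)⁻¹` and `P := (βΣ⁻¹ + Σ_t⁻¹ + (β/κ)C⁻¹)⁻¹`, the drift
matrix `(γβ/κ) P Σ⁻¹` of the mean ODE of localized consensus-based sampling equals `c`
times the drift matrix `α'Σ_t(Σ + α'Σ_t)⁻¹` of the mean ODE of consensus-based sampling
with parameter `α'`. -/
theorem lcbs_mean_ode_eq_cbs_mean_ode {d : ℕ} (hd : 1 ≤ d)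
    (S St : Matrix (Fin d) (Fin d) ℝ) (hS : S.PosDef) (hSt : St.PosDef)
    (α α' : ℝ) (hα : 0 < α) (hα' : 0 < α')
    (κ β γ c : ℝ) (hκ : κ = α) (hβ : β = α') (hγ : γ = 2 * α' / (α' + 1))
    (hc : c = α' / (α * (α' + 1)))
    (C P : Matrix (Fin d) (Fin d) ℝ)
    (hC : C = (α • S⁻¹ + (α / α') • St⁻¹)⁻¹)
    (hP : P = (β • S⁻¹ + St⁻¹ + (β / κ) • C⁻¹)⁻¹) :
    (γ * β / κ) • (P * S⁻¹) = (c * α') • (St * (S + α' • St)⁻¹) := by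
  have hM : IsUnit (α • S⁻¹ + (α / α') • St⁻¹).det :=
    ((hS.inv.smul hα).add (hSt.inv.smul (div_pos hα hα'))).det_pos.ne'.isUnit
  have hSu : IsUnit S.det := hS.det_pos.ne'.isUnit
  have hStu : IsUnit St.det := hSt.det_pos.ne'.isUnit
  have hDu : IsUnit (S + α' • St).det := (hS.add (hSt.smul hα')).det_pos.ne'.isUnit
  have hPinv : β • S⁻¹ + St⁻¹ + (β / κ) • C⁻¹ = (2 : ℝ) • (α' • S⁻¹ + St⁻¹) := by
    rw [hC, nonsing_inv_nonsing_inv _ hM, hβ, hκ, smul_add, smul_smul, smul_smul,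
      div_mul_cancel₀ _ hα.ne', div_mul_div_cancel₀ hα.ne', div_self hα'.ne', one_smul,
      two_smul]
  have hfactor : S * ((2 : ℝ) • (α' • S⁻¹ + St⁻¹)) = (2 : ℝ) • ((S + α' • St) * St⁻¹) := by
    rw [mul_smul_comm, mul_add, add_mul, mul_smul_comm, smul_mul_assoc,
      mul_nonsing_inv _ hSu, mul_nonsing_inv _ hStu, add_comm]
  have hdet : IsUnit ((S + α' • St) * St⁻¹).det := by
    rw [det_mul]
    exact hDu.mul hSt.inv.det_pos.ne'.isUnit
  have hPS : P * S⁻¹ = (2 : ℝ)⁻¹ • (St * (S + α' • St)⁻¹) := by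
    rw [hP, hPinv, ← Matrix.mul_inv_rev, hfactor, Matrix.inv_smul _ _ hdet,
      Matrix.mul_inv_rev, nonsing_inv_nonsing_inv _ hStu, invOf_eq_inv]
  rw [hPS, smul_smul, hγ, hβ, hκ, hc]
  congr 1
  field_simp
end
end

section
/- Let π̂: ℝ^d → [0,∞) be measurable, a ≥ 0, and A ∈ ℝ^{d×d} symmetric positive definite. Let M ∈ ℝ^{d×d} be invertible, b ∈ ℝ^d, T(z) := Mz + b, π̃ := π̂ ∘ T, and Ã := M⁻¹ A M⁻ᵀ. Let ρ̄ be a probability measure on ℝ^d and ρ := T_*ρ̄ its pushforward under T. Fix z ∈ ℝ^d and set u := Mz + b. Assume that 0 < ∫ w^{π̃}_{a,Ã}(z'; z) dρ̄(z') < ∞ and that z' ↦ ‖z'‖ w^{π̃}_{a,Ã}(z'; z) is ρ̄-integrable. Then the localized weighted mean is affine-equivariant: μ^{π̂}_{a,A}(ρ; u) = M μ^{π̃}_{a,Ã}(ρ̄; z) + b. -/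
open MeasureTheory Matrix Real

noncomputable section

lemma dotProduct_inv_mulVec_congruence {n : Type*} [Fintype n] [DecidableEq n]
    (A : Matrix n n ℝ) {M : Matrix n n ℝ} (hM : IsUnit M.det) (x : n → ℝ) :
    x ⬝ᵥ ((M⁻¹ * A * (M⁻¹)ᵀ)⁻¹ *ᵥ x) = (M *ᵥ x) ⬝ᵥ (A⁻¹ *ᵥ (M *ᵥ x)) := by
  have hinv : (M⁻¹ * A * (M⁻¹)ᵀ)⁻¹ = Mᵀ * (A⁻¹ * M) := by
    rw [Matrix.mul_inv_rev, Matrix.mul_inv_rev, ← Matrix.transpose_nonsing_inv,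
      Matrix.nonsing_inv_nonsing_inv M hM]
  rw [hinv, ← Matrix.mulVec_mulVec, ← Matrix.mulVec_mulVec, Matrix.dotProduct_mulVec,
    Matrix.vecMul_transpose]

lemma locw_affine {d : ℕ} (pih : (Fin d → ℝ) → ℝ) (a : ℝ) (A : Matrix (Fin d) (Fin d) ℝ)
    {M : Matrix (Fin d) (Fin d) ℝ} (hM : IsUnit M.det) (b z v : Fin d → ℝ) :
    locw pih a A (M *ᵥ z + b) (M *ᵥ v + b) =
      locw (fun x => pih (M *ᵥ x + b)) a (M⁻¹ * A * (M⁻¹)ᵀ) z v := by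
  simp only [locw]
  rw [dotProduct_inv_mulVec_congruence A hM, add_sub_add_right_eq_sub, ← Matrix.mulVec_sub]

lemma measurable_locw {d : ℕ} {pih : (Fin d → ℝ) → ℝ} (hmeas : Measurable pih) (a : ℝ)
    (A : Matrix (Fin d) (Fin d) ℝ) (u : Fin d → ℝ) : Measurable (locw pih a A u) := by
  have hcont : Continuous fun v : Fin d → ℝ =>
      Real.exp (-(1 / 2) * ((v - u) ⬝ᵥ (A⁻¹ *ᵥ (v - u)))) := by
    fun_prop
  exact hcont.measurable.mul (hmeas.pow_const a)

lemma integrable_mul_apply {d : ℕ} {w : (Fin d → ℝ) → ℝ} {ρ : Measure (Fin d → ℝ)}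
    (hw : Integrable w ρ) (hw1 : Integrable (fun v => ‖v‖ * w v) ρ) (i : Fin d) :
    Integrable (fun v => w v * v i) ρ := by
  refine hw1.mono
    (hw.aestronglyMeasurable.mul (measurable_pi_apply i).aestronglyMeasurable)
    (.of_forall fun v => ?_)
  rw [norm_mul, norm_mul, norm_norm, mul_comm]
  gcongr
  exact norm_le_pi_norm v i

lemma wMean_map_affine {d : ℕ} {w : (Fin d → ℝ) → ℝ} (hmeas : Measurable w)
    (M : Matrix (Fin d) (Fin d) ℝ) (b : Fin d → ℝ) {ρ : Measure (Fin d → ℝ)}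
    (hne : ∫ v, w (M *ᵥ v + b) ∂ρ ≠ 0) (hw : Integrable (fun v => w (M *ᵥ v + b)) ρ)
    (hw1 : Integrable (fun v => ‖v‖ * w (M *ᵥ v + b)) ρ) :
    wMean w (Measure.map (fun v => M *ᵥ v + b) ρ) =
      M *ᵥ wMean (fun v => w (M *ᵥ v + b)) ρ + b := by
  have hT : Measurable fun v : Fin d → ℝ => M *ᵥ v + b :=
    Continuous.measurable (by fun_prop)
  have hcoord (j : Fin d) := integrable_mul_apply hw hw1 j
  ext i
  have hnum : ∫ v, w (M *ᵥ v + b) * (M *ᵥ v + b) i ∂ρ =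
      ∑ j, M i j * ∫ v, w (M *ᵥ v + b) * v j ∂ρ + (∫ v, w (M *ᵥ v + b) ∂ρ) * b i := by
    have hexpand (v : Fin d → ℝ) : w (M *ᵥ v + b) * (M *ᵥ v + b) i =
        ∑ j, M i j * (w (M *ᵥ v + b) * v j) + w (M *ᵥ v + b) * b i := by
      rw [Pi.add_apply, mul_add, Matrix.mulVec, dotProduct, Finset.mul_sum]
      simp only [mul_left_comm]
    simp only [hexpand]
    rw [integral_add (integrable_finsetSum _ fun j _ => (hcoord j).const_mul _) (hw.mul_const _),
      integral_finsetSum _ fun j _ => (hcoord j).const_mul _, integral_mul_const]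
    simp only [integral_const_mul]
  have hmeas_mul : Measurable fun v => w v * v i := hmeas.mul (measurable_pi_apply i)
  rw [wMean, integral_map hT.aemeasurable hmeas.aestronglyMeasurable,
    integral_map hT.aemeasurable hmeas_mul.aestronglyMeasurable,
    hnum, add_div, mul_div_cancel_left₀ _ hne, Finset.sum_div]
  simp only [wMean, Pi.add_apply, Matrix.mulVec, dotProduct, mul_div_assoc]

/-- Affine equivariance of the localized weighted mean: with `T(z) = Mz + b`,
`π̃ = π̂ ∘ T`, `Ã = M⁻¹ A M⁻ᵀ`, `ρ = T_*ρb` and `u = Mz + b`, one has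
`μ^{π̂}_{a,A}(ρ; u) = M μ^{π̃}_{a,Ã}(ρb; z) + b`. -/
theorem locMean_affine_equivariant {d : ℕ} (hd : 1 ≤ d)
    (pih : (Fin d → ℝ) → ℝ) (hmeas : Measurable pih) (hnonneg : ∀ v, 0 ≤ pih v)
    (a : ℝ) (ha : 0 ≤ a) (A : Matrix (Fin d) (Fin d) ℝ) (hA : A.PosDef)
    (M : Matrix (Fin d) (Fin d) ℝ) (hM : IsUnit M.det) (b : Fin d → ℝ)
    (ρb : Measure (Fin d → ℝ)) [IsProbabilityMeasure ρb] (z : Fin d → ℝ)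
    (hw0 : 0 < ∫ z', locw (fun z'' => pih (M *ᵥ z'' + b)) a (M⁻¹ * A * (M⁻¹)ᵀ) z z' ∂ρb)
    (hwInt : Integrable
      (fun z' => locw (fun z'' => pih (M *ᵥ z'' + b)) a (M⁻¹ * A * (M⁻¹)ᵀ) z z') ρb)
    (hwInt1 : Integrable
      (fun z' => ‖z'‖ * locw (fun z'' => pih (M *ᵥ z'' + b)) a (M⁻¹ * A * (M⁻¹)ᵀ) z z') ρb) :
    wMean (locw pih a A (M *ᵥ z + b)) (Measure.map (fun z' => M *ᵥ z' + b) ρb) =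
      M *ᵥ wMean (locw (fun z'' => pih (M *ᵥ z'' + b)) a (M⁻¹ * A * (M⁻¹)ᵀ) z) ρb + b := by
  simp only [← locw_affine pih a A hM b z] at hw0 hwInt hwInt1
  rw [wMean_map_affine (measurable_locw hmeas a A _) M b hw0.ne' hwInt hwInt1]
  simp only [locw_affine pih a A hM b z]
end
end

section
/- Let π̂: ℝ^d → [0,∞) be measurable, a ≥ 0, and A ∈ ℝ^{d×d} symmetric positive definite. Let M ∈ ℝ^{d×d} be invertible, b ∈ ℝ^d, T(z) := Mz + b, π̃ := π̂ ∘ T, and Ã := M⁻¹ A M⁻ᵀ. Let ρ̄ be a probability measure on ℝ^d and ρ := T_*ρ̄ its pushforward under T. Fix z ∈ ℝ^d and set u := Mz + b. Assume that 0 < ∫ w^{π̃}_{a,Ã}(z'; z) dρ̄(z') < ∞ and that z' ↦ ‖z'‖² w^{π̃}_{a,Ã}(z'; z) is ρ̄-integrable. Then the localized weighted covariance is affine-equivariant: C^{π̂}_{a,A}(ρ; u) = M C^{π̃}_{a,Ã}(ρ̄; z) Mᵀ. In particular, the localized weighted covariance preconditioner of localized consensus-based sampling transforms covariantly under affine changes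 of variables. -/
open MeasureTheory Matrix Real

noncomputable section

/-- A continuous function of at most quadratic growth is integrable against a weight with finite
zeroth and second moments. -/
theorem integrable_weight_mul {d : ℕ} {w : (Fin d → ℝ) → ℝ} {ρ : Measure (Fin d → ℝ)}
    (hw : Integrable w ρ) (hw2 : Integrable (fun v => ‖v‖ ^ 2 * w v) ρ)
    {f : (Fin d → ℝ) → ℝ} (hf : Continuous f) (C : ℝ)
    (hC : ∀ v, |f v| ≤ C * (1 + ‖v‖ ^ 2)) : Integrable (fun v => w v * f v) ρ := by
  refine ((hw.norm.add hw2.norm).const_mul C).mono'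
    (hw.aestronglyMeasurable.mul hf.aestronglyMeasurable) (.of_forall fun v => ?_)
  simp only [Pi.add_apply, norm_mul, norm_pow, Real.norm_eq_abs, abs_norm]
  nlinarith [mul_le_mul_of_nonneg_left (hC v) (abs_nonneg (w v))]

theorem integrable_weight_mul_apply {d : ℕ} {w : (Fin d → ℝ) → ℝ} {ρ : Measure (Fin d → ℝ)}
    (hw : Integrable w ρ) (hw2 : Integrable (fun v => ‖v‖ ^ 2 * w v) ρ) (i : Fin d) :
    Integrable (fun v => w v * v i) ρ := by
  refine integrable_weight_mul hw hw2 (continuous_apply i) 1 fun v => ?_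
  have h : |v i| ≤ ‖v‖ := norm_le_pi_norm v i
  nlinarith [sq_nonneg (‖v‖ - 1), norm_nonneg v]

theorem integrable_weight_mul_sub_mul_sub {d : ℕ} {w : (Fin d → ℝ) → ℝ}
    {ρ : Measure (Fin d → ℝ)} (hw : Integrable w ρ)
    (hw2 : Integrable (fun v => ‖v‖ ^ 2 * w v) ρ) (m : Fin d → ℝ) (i j : Fin d) :
    Integrable (fun v => w v * ((v i - m i) * (v j - m j))) ρ := by
  refine integrable_weight_mul hw hw2 (by fun_prop) (2 * (1 + ‖m‖ ^ 2)) fun v => ?_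
  have hi : |v i - m i| ≤ ‖v‖ + ‖m‖ := (norm_le_pi_norm (v - m) i).trans (norm_sub_le v m)
  have hj : |v j - m j| ≤ ‖v‖ + ‖m‖ := (norm_le_pi_norm (v - m) j).trans (norm_sub_le v m)
  rw [abs_mul]
  nlinarith [mul_le_mul hi hj (abs_nonneg _) (by positivity), sq_nonneg (‖v‖ - ‖m‖),
    mul_nonneg (sq_nonneg ‖v‖) (sq_nonneg ‖m‖)]

theorem measurableEmbedding_mulVec_add {d : ℕ} {M : Matrix (Fin d) (Fin d) ℝ}
    (hM : IsUnit M.det) (b : Fin d → ℝ) : MeasurableEmbedding fun v => M *ᵥ v + b := by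
  have hinj : Function.Injective fun v => M *ᵥ v + b := fun x y h =>
    mulVec_injective_iff_isUnit.mpr ((isUnit_iff_isUnit_det M).mpr hM) (add_right_cancel h)
  have hcont : Continuous fun v : Fin d → ℝ => M *ᵥ v + b := by fun_prop
  exact hcont.measurableEmbedding hinj

theorem wMean_map_mulVec_add {d : ℕ} (w : (Fin d → ℝ) → ℝ) {M : Matrix (Fin d) (Fin d) ℝ}
    (hM : IsUnit M.det) (b : Fin d → ℝ) (ρ : Measure (Fin d → ℝ))
    (h0 : ∫ v, w (M *ᵥ v + b) ∂ρ ≠ 0) (hw : Integrable (fun v => w (M *ᵥ v + b)) ρ)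
    (hw2 : Integrable (fun v => ‖v‖ ^ 2 * w (M *ᵥ v + b)) ρ) :
    wMean w (ρ.map fun v => M *ᵥ v + b) = M *ᵥ wMean (fun v => w (M *ᵥ v + b)) ρ + b := by
  have hT := measurableEmbedding_mulVec_add hM b
  ext i
  have hint : ∀ k, Integrable (fun v => M i k * (w (M *ᵥ v + b) * v k)) ρ := fun k =>
    (integrable_weight_mul_apply hw hw2 k).const_mul _
  have hpt : ∀ v, w (M *ᵥ v + b) * (M *ᵥ v + b) i =
      ∑ k, M i k * (w (M *ᵥ v + b) * v k) + w (M *ᵥ v + b) * b i := fun v => by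
    simp only [Pi.add_apply, mulVec, dotProduct, mul_add, Finset.mul_sum]
    congr 1
    exact Finset.sum_congr rfl fun k _ => by ring
  simp only [wMean, hT.integral_map, hpt]
  rw [integral_add (integrable_finsetSum _ fun k _ => hint k) (hw.mul_const _),
    integral_finsetSum _ fun k _ => hint k, integral_mul_const, add_div,
    mul_div_cancel_left₀ _ h0, Finset.sum_div]
  simp only [integral_const_mul, mul_div_assoc, Pi.add_apply, mulVec, dotProduct]
  rfl

theorem wCov_map_mulVec_add {d : ℕ} (w : (Fin d → ℝ) → ℝ) {M : Matrix (Fin d) (Fin d) ℝ}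
    (hM : IsUnit M.det) (b : Fin d → ℝ) (ρ : Measure (Fin d → ℝ))
    (h0 : ∫ v, w (M *ᵥ v + b) ∂ρ ≠ 0) (hw : Integrable (fun v => w (M *ᵥ v + b)) ρ)
    (hw2 : Integrable (fun v => ‖v‖ ^ 2 * w (M *ᵥ v + b)) ρ) :
    wCov w (ρ.map fun v => M *ᵥ v + b) = M * wCov (fun v => w (M *ᵥ v + b)) ρ * Mᵀ := by
  have hT := measurableEmbedding_mulVec_add hM b
  ext i j
  simp only [wCov, of_apply, mul_apply, transpose_apply, hT.integral_map,
    wMean_map_mulVec_add w hM b ρ h0 hw hw2]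
  set m := wMean (fun v => w (M *ᵥ v + b)) ρ
  have hint : ∀ k l, Integrable
      (fun v => M i k * (w (M *ᵥ v + b) * ((v k - m k) * (v l - m l))) * M j l) ρ := fun k l =>
    ((integrable_weight_mul_sub_mul_sub hw hw2 m k l).const_mul _).mul_const _
  have hcoord : ∀ v i, (M *ᵥ v + b) i - (M *ᵥ m + b) i = ∑ k, M i k * (v k - m k) :=
    fun v i => by simp [mulVec, dotProduct, mul_sub, Finset.sum_sub_distrib]
  have hpt : ∀ v, w (M *ᵥ v + b) *
      (((M *ᵥ v + b) i - (M *ᵥ m + b) i) * ((M *ᵥ v + b) j - (M *ᵥ m + b) j)) =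
      ∑ l, ∑ k, M i k * (w (M *ᵥ v + b) * ((v k - m k) * (v l - m l))) * M j l := fun v => by
    rw [hcoord, hcoord, Finset.sum_mul_sum, Finset.sum_comm, Finset.mul_sum]
    refine Finset.sum_congr rfl fun l _ => ?_
    rw [Finset.mul_sum]
    exact Finset.sum_congr rfl fun k _ => by ring
  simp only [hpt]
  rw [integral_finsetSum _ fun l _ => integrable_finsetSum _ fun k _ => hint k l,
    Finset.sum_div]
  refine Finset.sum_congr rfl fun l _ => ?_
  rw [integral_finsetSum _ fun k _ => hint k l, Finset.sum_div, Finset.sum_mul]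
  refine Finset.sum_congr rfl fun k _ => ?_
  rw [integral_mul_const, integral_const_mul]
  ring

/-- The localized weight is invariant under affine changes of variables. -/
theorem locw_mulVec_add {d : ℕ} (pih : (Fin d → ℝ) → ℝ) (a : ℝ)
    (A : Matrix (Fin d) (Fin d) ℝ) {M : Matrix (Fin d) (Fin d) ℝ} (hM : IsUnit M.det)
    (b z v : Fin d → ℝ) :
    locw pih a A (M *ᵥ z + b) (M *ᵥ v + b) =
      locw (fun y => pih (M *ᵥ y + b)) a (M⁻¹ * A * (M⁻¹)ᵀ) z v := by
  have hinv : (M⁻¹ * A * (M⁻¹)ᵀ)⁻¹ = Mᵀ * (A⁻¹ * M) := by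
    rw [Matrix.mul_inv_rev, Matrix.mul_inv_rev, transpose_nonsing_inv, nonsing_inv_nonsing_inv _ hM,
      nonsing_inv_nonsing_inv _ (by rwa [det_transpose])]
  have hsub : M *ᵥ v + b - (M *ᵥ z + b) = M *ᵥ (v - z) := by
    rw [mulVec_sub, add_sub_add_right_eq_sub]
  simp only [locw, hinv, hsub, ← mulVec_mulVec, dotProduct_mulVec _ Mᵀ, vecMul_transpose]

/-- Affine equivariance of the localized weighted covariance: with `T(z) = Mz + b`,
`π̃ = π̂ ∘ T`, `Ã = M⁻¹ A M⁻ᵀ`, `ρ = T_*ρb` and `u = Mz + b`, one has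
`C^{π̂}_{a,A}(ρ; u) = M C^{π̃}_{a,Ã}(ρb; z) Mᵀ`; i.e. the localized weighted covariance
preconditioner transforms covariantly under affine changes of variables. -/
theorem locCov_affine_equivariant {d : ℕ} (hd : 1 ≤ d)
    (pih : (Fin d → ℝ) → ℝ) (hmeas : Measurable pih) (hnonneg : ∀ v, 0 ≤ pih v)
    (a : ℝ) (ha : 0 ≤ a) (A : Matrix (Fin d) (Fin d) ℝ) (hA : A.PosDef)
    (M : Matrix (Fin d) (Fin d) ℝ) (hM : IsUnit M.det) (b : Fin d → ℝ)
    (ρb : Measure (Fin d → ℝ)) [IsProbabilityMeasure ρb] (z : Fin d → ℝ)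
    (hw0 : 0 < ∫ z', locw (fun z'' => pih (M *ᵥ z'' + b)) a (M⁻¹ * A * (M⁻¹)ᵀ) z z' ∂ρb)
    (hwInt : Integrable
      (fun z' => locw (fun z'' => pih (M *ᵥ z'' + b)) a (M⁻¹ * A * (M⁻¹)ᵀ) z z') ρb)
    (hwInt2 : Integrable
      (fun z' => ‖z'‖ ^ 2 * locw (fun z'' => pih (M *ᵥ z'' + b)) a (M⁻¹ * A * (M⁻¹)ᵀ) z z') ρb) :
    wCov (locw pih a A (M *ᵥ z + b)) (Measure.map (fun z' => M *ᵥ z' + b) ρb) =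
      M * wCov (locw (fun z'' => pih (M *ᵥ z'' + b)) a (M⁻¹ * A * (M⁻¹)ᵀ) z) ρb * Mᵀ := by
  simp only [← locw_mulVec_add pih a A hM b z] at hw0 hwInt hwInt2
  rw [wCov_map_mulVec_add _ hM b ρb hw0.ne' hwInt hwInt2]
  simp only [locw_mulVec_add pih a A hM b z]
end
end

section
/- Assume Ĉ := Ĉ(U¹,…,U^J) is invertible. Then, with X^{ik} ∈ ℝ^d defined componentwise by X^{ik}_ℓ := (U^i − U^k)ᵀ Ĉ⁻¹ D_ℓ Ĉ⁻¹ (U^i − U^k), D_ℓ := J⁻¹((U^i−Ū)e_ℓᵀ + e_ℓ(U^i−Ū)ᵀ), the weighted sum satisfies ∑_{k=1}^J ω^{ik} X^{ik}/2 = J⁻¹ Ĉ⁻¹ ((U^i − Ū^{(i)})(U^i − Ū^{(i)})ᵀ + Ĉ_w) Ĉ⁻¹ (U^i − Ū). -/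
open Matrix

noncomputable section

/-- Sample mean `Ū := (1/J)∑ⱼ Uʲ` of an ensemble of `J` particles in `ℝ^d`. -/
def sMean {d J : ℕ} (U : Fin J → Fin d → ℝ) : Fin d → ℝ :=
  (J : ℝ)⁻¹ • ∑ j, U j

/-- Sample covariance `Ĉ(U¹,…,U^J) := (1/J)∑ⱼ (Uʲ−Ū)(Uʲ−Ū)ᵀ`. -/
def sCov {d J : ℕ} (U : Fin J → Fin d → ℝ) : Matrix (Fin d) (Fin d) ℝ :=
  (J : ℝ)⁻¹ • ∑ j, vecMulVec (U j - sMean U) (U j - sMean U)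

/-- `D_ℓ := J⁻¹((Uⁱ−Ū)e_ℓᵀ + e_ℓ(Uⁱ−Ū)ᵀ)`. -/
def Dmat {d J : ℕ} (U : Fin J → Fin d → ℝ) (i : Fin J) (ℓ : Fin d) :
    Matrix (Fin d) (Fin d) ℝ :=
  (J : ℝ)⁻¹ • (vecMulVec (U i - sMean U) (Pi.single ℓ 1) +
    vecMulVec (Pi.single ℓ 1) (U i - sMean U))

/-- The vector `X^{ik}` with components `X^{ik}_ℓ = (Uⁱ−Uᵏ)ᵀ Ĉ⁻¹ D_ℓ Ĉ⁻¹ (Uⁱ−Uᵏ)`. -/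
def Xvec {d J : ℕ} (U : Fin J → Fin d → ℝ) (i k : Fin J) : Fin d → ℝ :=
  fun ℓ => (U i - U k) ⬝ᵥ (((sCov U)⁻¹ * Dmat U i ℓ * (sCov U)⁻¹) *ᵥ (U i - U k))

/-- Unnormalized localized weight `w^{ik}` at `u = Uⁱ`:
`w^{ik} = exp(−(1/(2λ))(Uⁱ−Uᵏ)ᵀĈ⁻¹(Uⁱ−Uᵏ)) π̂(Uᵏ)^α`. -/
def wgt {d J : ℕ} (l α : ℝ) (pih : (Fin d → ℝ) → ℝ) (U : Fin J → Fin d → ℝ)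
    (i k : Fin J) : ℝ :=
  Real.exp (-(1 / (2 * l)) * ((U i - U k) ⬝ᵥ ((sCov U)⁻¹ *ᵥ (U i - U k)))) *
    pih (U k) ^ α

/-- Normalized localized weight `ω^{ik} = w^{ik} / ∑_{k'} w^{ik'}` at `u = Uⁱ`. -/
def omg {d J : ℕ} (l α : ℝ) (pih : (Fin d → ℝ) → ℝ) (U : Fin J → Fin d → ℝ)
    (i k : Fin J) : ℝ :=
  wgt l α pih U i k / ∑ k', wgt l α pih U i k'

/-- Localized mean `Ū^{(i)} := ∑ⱼ ω^{ij} Uʲ`. -/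
def locM {d J : ℕ} (l α : ℝ) (pih : (Fin d → ℝ) → ℝ) (U : Fin J → Fin d → ℝ)
    (i : Fin J) : Fin d → ℝ :=
  ∑ j, omg l α pih U i j • U j

/-- Localized sample covariance `Ĉ_w := ∑ⱼ ω^{ij}(Uʲ−Ū^{(i)})(Uʲ−Ū^{(i)})ᵀ`. -/
def locC {d J : ℕ} (l α : ℝ) (pih : (Fin d → ℝ) → ℝ) (U : Fin J → Fin d → ℝ)
    (i : Fin J) : Matrix (Fin d) (Fin d) ℝ :=
  ∑ j, omg l α pih U i j •
    vecMulVec (U j - locM l α pih U i) (U j - locM l α pih U i)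

theorem sCov_isSymm {d J : ℕ} (U : Fin J → Fin d → ℝ) : (sCov U).IsSymm := by
  simp [sCov, Matrix.IsSymm, transpose_smul, transpose_sum, transpose_vecMulVec]

theorem sum_omg {d J : ℕ} (l α : ℝ) (pih : (Fin d → ℝ) → ℝ) (hpos : ∀ v, 0 < pih v)
    (U : Fin J → Fin d → ℝ) (i : Fin J) : ∑ k, omg l α pih U i k = 1 := by
  have hw : 0 < ∑ k, wgt l α pih U i k :=
    Finset.sum_pos (fun k _ => mul_pos (Real.exp_pos _) (Real.rpow_pos_of_pos (hpos _) _))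
      ⟨i, Finset.mem_univ i⟩
  simp only [omg, ← Finset.sum_div]
  exact div_self hw.ne'

/-- Half of `X^{ik}` as a matrix applied to `Uⁱ − Ū`. -/
theorem half_smul_Xvec {d J : ℕ} (U : Fin J → Fin d → ℝ) (i k : Fin J) :
    (2 : ℝ)⁻¹ • Xvec U i k =
      (J : ℝ)⁻¹ • (((sCov U)⁻¹ * vecMulVec (U i - U k) (U i - U k) * (sCov U)⁻¹) *ᵥ
        (U i - sMean U)) := by
  have hP : ((sCov U)⁻¹)ᵀ = (sCov U)⁻¹ := by
    rw [transpose_nonsing_inv, (sCov_isSymm U).eq]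
  ext ℓ
  simp only [Xvec, Dmat, Pi.smul_apply, smul_eq_mul]
  generalize (sCov U)⁻¹ = P at hP ⊢
  generalize U i - sMean U = m
  generalize U i - U k = v
  have hcomm : m ⬝ᵥ (P *ᵥ v) = v ⬝ᵥ (P *ᵥ m) := by
    rw [dotProduct_mulVec, ← mulVec_transpose, hP, dotProduct_comm]
  simp only [← mulVec_mulVec, smul_mulVec, add_mulVec, vecMulVec_mulVec, mulVec_smul,
    mulVec_add, op_smul_eq_smul, dotProduct_smul, dotProduct_add, smul_eq_mul, Pi.smul_apply,
    single_one_dotProduct, hcomm]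
  have hsingle : v ⬝ᵥ (P *ᵥ Pi.single ℓ 1) = (P *ᵥ v) ℓ := by
    rw [dotProduct_mulVec, ← mulVec_transpose, hP, dotProduct_single_one]
  rw [hsingle]
  ring

/-- Decomposition of a weighted second moment about `a` into squared bias and covariance. -/
theorem sum_smul_vecMulVec_sub {ι n : Type*} [Fintype ι] (c : ι → ℝ) (hc : ∑ k, c k = 1)
    (x : ι → n → ℝ) (a : n → ℝ) :
    ∑ k, c k • vecMulVec (a - x k) (a - x k) =
      vecMulVec (a - ∑ k, c k • x k) (a - ∑ k, c k • x k) +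
        ∑ k, c k • vecMulVec (x k - ∑ j, c j • x j) (x k - ∑ j, c j • x j) := by
  obtain ⟨M, hM⟩ : ∃ M, M = ∑ j, c j • x j := ⟨_, rfl⟩
  rw [← hM]
  have hMp (p : n) : ∑ k, c k * x k p = M p := by simp [hM, Finset.sum_apply]
  ext p q
  simp only [Matrix.sum_apply, Matrix.add_apply, Matrix.smul_apply, vecMulVec_apply,
    Pi.sub_apply, smul_eq_mul]
  have key : ∑ k, (c k * ((a p - x k p) * (a q - x k q)) -
      c k * ((x k p - M p) * (x k q - M q))) =
      (a p * a q - M p * M q) * ∑ k, c k - (a p - M p) * ∑ k, c k * x k q -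
        (a q - M q) * ∑ k, c k * x k p := by
    simp only [Finset.mul_sum, ← Finset.sum_sub_distrib]
    exact Finset.sum_congr rfl fun k _ => by ring
  rw [Finset.sum_sub_distrib, hc, hMp, hMp] at key
  linarith

/-- If `Ĉ` is invertible, the weighted sum of the `X^{ik}/2` satisfies
`∑ₖ ω^{ik} X^{ik}/2 = J⁻¹ Ĉ⁻¹((Uⁱ−Ū^{(i)})(Uⁱ−Ū^{(i)})ᵀ + Ĉ_w)Ĉ⁻¹(Uⁱ−Ū)`. -/
theorem weighted_sum_Xvec {d J : ℕ} (hd : 1 ≤ d) (hJ : 1 ≤ J)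
    (l α : ℝ) (hl : 0 < l) (hα : 0 ≤ α)
    (pih : (Fin d → ℝ) → ℝ) (hpos : ∀ v, 0 < pih v)
    (U : Fin J → Fin d → ℝ) (hC : IsUnit (sCov U).det) (i : Fin J) :
    ∑ k, omg l α pih U i k • ((2 : ℝ)⁻¹ • Xvec U i k) =
      (J : ℝ)⁻¹ • (((sCov U)⁻¹ *
        (vecMulVec (U i - locM l α pih U i) (U i - locM l α pih U i) +
          locC l α pih U i) * (sCov U)⁻¹) *ᵥ (U i - sMean U)) := by
  simp only [half_smul_Xvec, locC, locM]
  rw [← sum_smul_vecMulVec_sub _ (sum_omg l α pih hpos U i) U (U i)]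
  simp only [Finset.mul_sum, Finset.sum_mul, sum_mulVec, Finset.smul_sum, mul_smul_comm,
    smul_mul_assoc, smul_mulVec]
  exact Finset.sum_congr rfl fun k _ => smul_comm _ _ _
end
end
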